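/- arXiv:1305.7004 — 2 statements merged into one kernel-verified Lean document; each statement's English description precedes it below -/
import Mathlib

section
/- Let R be a commutative Noetherian ring, a an ideal, M a finitely generated R-module, and n a nonnegative integer. Then h^n_a(M) ≤ f^n_a(M), where h^n_a(M) is the least integer i such that H^i_a(M) is not in dimension < n, and f^n_a(M) = inf{ f_{aR_p}(M_p) : p ∈ Supp(M/aM), dim R/p ≥ n }. -/
open CategoryTheory

universe u

/-- An `R`-module `M` is *in dimension `< n`* if there is a finitely generated submodule `N`
of `M` such that the Krull dimension of `Supp (M/N)` is `< n`. -/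
def InDimLT (R : Type u) [CommRing R] (M : Type u) [AddCommGroup M] [Module R M]
    (n : ℕ) : Prop :=
  ∃ N : Submodule R M, N.FG ∧
    Order.krullDim (Module.support R (M ⧸ N)) < (n : WithBot ℕ∞)

/-- `f_a(M)`: the least `i` such that `H^i_a(M)` is not finitely generated (`⊤` if none). -/
noncomputable def fDim (R : Type u) [CommRing R] (a : Ideal R)
    (M : Type u) [AddCommGroup M] [Module R M] : ℕ∞ :=
  sInf {i : ℕ∞ | ∃ j : ℕ, i = j ∧
    ¬ Module.Finite R ((localCohomology a j).obj (ModuleCat.of R M))}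

/-- `f^n_a(M) = inf { f_{aR_p}(M_p) : p ∈ Supp(M/aM), dim R/p ≥ n }`. -/
noncomputable def fDimN (R : Type u) [CommRing R] (a : Ideal R)
    (M : Type u) [AddCommGroup M] [Module R M] (n : ℕ) : ℕ∞ :=
  sInf {i : ℕ∞ | ∃ p : PrimeSpectrum R,
    p ∈ Module.support R (M ⧸ (a • ⊤ : Submodule R M)) ∧
    (n : WithBot ℕ∞) ≤ ringKrullDim (R ⧸ p.asIdeal) ∧
    i = fDim (Localization.AtPrime p.asIdeal)
          (a.map (algebraMap R (Localization.AtPrime p.asIdeal)))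
          (LocalizedModule p.asIdeal.primeCompl M)}

/-- `h^n_a(M)`: the least `i` such that `H^i_a(M)` is not in dimension `< n` (`⊤` if none). -/
noncomputable def hDim (R : Type u) [CommRing R] (a : Ideal R)
    (M : Type u) [AddCommGroup M] [Module R M] (n : ℕ) : ℕ∞ :=
  sInf {i : ℕ∞ | ∃ j : ℕ, i = j ∧
    ¬ InDimLT R ((localCohomology a j).obj (ModuleCat.of R M)) n}

open Opposite Limits

namespace HomologicalComplex

variable {A : Type*} [Ring A] {ι : Type*} {c : ComplexShape ι}
  (K : HomologicalComplex (ModuleCat.{u} A)ᵒᵖ c) {i : ι}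

/-- For a complex in the opposite of a module category, `K.Represents x e` says that `x` is a
cocycle whose cohomology class is `e`. -/
def Represents (x : (K.X i).unop) (e : (K.homology i).unop) : Prop :=
  ∃ z : (K.opcycles i).unop, (K.pOpcycles i).unop.hom z = x ∧ (K.homologyι i).unop.hom z = e

variable {K}

lemma Represents.unique {x : (K.X i).unop} {e e' : (K.homology i).unop}
    (h : K.Represents x e) (h' : K.Represents x e') : e = e' := by
  obtain ⟨z, rfl, rfl⟩ := h
  obtain ⟨z', hz, rfl⟩ := h'
  rw [(ModuleCat.mono_iff_injective (K.pOpcycles i).unop).1 inferInstance hz]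

lemma Represents.add {x x' : (K.X i).unop} {e e' : (K.homology i).unop}
    (h : K.Represents x e) (h' : K.Represents x' e') : K.Represents (x + x') (e + e') := by
  obtain ⟨z, rfl, rfl⟩ := h
  obtain ⟨z', rfl, rfl⟩ := h'
  exact ⟨z + z', map_add _ _ _, map_add _ _ _⟩

lemma Represents.smul (r : A) {x : (K.X i).unop} {e : (K.homology i).unop}
    (h : K.Represents x e) : K.Represents (r • x) (r • e) := by
  obtain ⟨z, rfl, rfl⟩ := h
  exact ⟨r • z, map_smul _ _ _, map_smul _ _ _⟩

lemma Represents.map {L : HomologicalComplex (ModuleCat.{u} A)ᵒᵖ c} (φ : L ⟶ K)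
    {x : (K.X i).unop} {e : (K.homology i).unop} (h : K.Represents x e) :
    L.Represents ((φ.f i).unop.hom x) ((homologyMap φ i).unop.hom e) := by
  obtain ⟨z, rfl, rfl⟩ := h
  refine ⟨(opcyclesMap φ i).unop.hom z, ?_, ?_⟩
  · exact congr($(congrArg Quiver.Hom.unop (p_opcyclesMap φ i)).hom z)
  · exact congr($(congrArg Quiver.Hom.unop (homologyι_naturality φ i)).hom z).symm

lemma Represents.d_apply_eq_zero {x : (K.X i).unop} {e : (K.homology i).unop}
    (h : K.Represents x e) (j : ι) : (K.d j i).unop.hom x = 0 := by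
  obtain ⟨z, rfl, -⟩ := h
  exact congr($(congrArg Quiver.Hom.unop (K.d_pOpcycles j i)).hom z)

lemma exists_represents_of_d_apply_eq_zero {x : (K.X i).unop} {j : ι} (hj : c.prev i = j)
    (hx : (K.d j i).unop.hom x = 0) : ∃ e, K.Represents x e := by
  have hexact := ShortComplex.exact_of_g_is_cokernel
    (ShortComplex.mk _ _ (K.d_pOpcycles j i)) (K.opcyclesIsCokernel j i hj)
  obtain ⟨z, hz⟩ := (ShortComplex.ShortExact.moduleCat_exact_iff_function_exact _).1
    hexact.unop x |>.1 hx
  exact ⟨_, z, hz, rfl⟩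

lemma exists_represents (e : (K.homology i).unop) : ∃ x, K.Represents x e := by
  obtain ⟨z, rfl⟩ := (ModuleCat.epi_iff_surjective (K.homologyι i).unop).1 inferInstance e
  exact ⟨_, z, rfl, rfl⟩

lemma represents_d_zero {j : ι} (y : (K.X j).unop) :
    K.Represents ((K.d i j).unop.hom y) 0 := by
  refine ⟨(K.fromOpcycles i j).unop.hom y, ?_, ?_⟩
  · exact congr($(congrArg Quiver.Hom.unop (K.p_fromOpcycles i j)).hom y)
  · exact congr($(congrArg Quiver.Hom.unop (K.homologyι_comp_fromOpcycles i j)).hom y)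

lemma Represents.exists_d_eq {x : (K.X i).unop} (h : K.Represents x 0) {j : ι}
    (hj : c.next i = j) : ∃ y, (K.d i j).unop.hom y = x := by
  obtain ⟨z, rfl, hz⟩ := h
  have hexact := ShortComplex.exact_of_f_is_kernel
    (ShortComplex.mk _ _ (K.homologyι_comp_fromOpcycles i j)) (K.homologyIsKernel i j hj)
  obtain ⟨y, rfl⟩ := (ShortComplex.ShortExact.moduleCat_exact_iff_function_exact _).1
    hexact.unop z |>.1 hz
  exact ⟨y, congr($(congrArg Quiver.Hom.unop (K.p_fromOpcycles i j)).hom y).symm⟩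

end HomologicalComplex

namespace CategoryTheory.ProjectiveResolution

variable {A : Type u} [CommRing A] {X X' Y : ModuleCat.{u} A} {n : ℕ}

/-- The complex `Hom(P, Y)`, as a complex in the opposite category. -/
noncomputable abbrev homComplex (P : ProjectiveResolution X) (Y : ModuleCat.{u} A) :
    HomologicalComplex (ModuleCat.{u} A)ᵒᵖ (ComplexShape.down ℕ) :=
  (((linearYoneda A (ModuleCat.{u} A)).obj Y).rightOp.mapHomologicalComplex _).obj P.complex

/-- The computation of `Ext^n(X, Y)` as the cohomology of `Hom(P, Y)`. -/
noncomputable def extEquiv (P : ProjectiveResolution X) (Y : ModuleCat.{u} A) (n : ℕ) :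
    ((Ext A (ModuleCat.{u} A) n).obj (op X)).obj Y ≃ₗ[A] ((P.homComplex Y).homology n).unop :=
  (P.isoLeftDerivedObj ((linearYoneda A (ModuleCat.{u} A)).obj Y).rightOp
    n).unop.symm.toLinearEquiv

/-- `P.ExtRep f e` says that `f : P.complex.X n ⟶ Y` is a cocycle representing the class
`e` in `Ext^n(X, Y)`. -/
def ExtRep (P : ProjectiveResolution X) (f : P.complex.X n ⟶ Y)
    (e : ((Ext A (ModuleCat.{u} A) n).obj (op X)).obj Y) : Prop :=
  (P.homComplex Y).Represents (i := n) f (P.extEquiv Y n e)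

variable {P : ProjectiveResolution X}

lemma ExtRep.add {f f' : P.complex.X n ⟶ Y}
    {e e' : ((Ext A (ModuleCat.{u} A) n).obj (op X)).obj Y}
    (h : P.ExtRep f e) (h' : P.ExtRep f' e') : P.ExtRep (f + f') (e + e') := by
  have := HomologicalComplex.Represents.add h h'
  rwa [← map_add] at this

lemma ExtRep.smul (r : A) {f : P.complex.X n ⟶ Y}
    {e : ((Ext A (ModuleCat.{u} A) n).obj (op X)).obj Y}
    (h : P.ExtRep f e) : P.ExtRep (r • f) (r • e) := by
  have := HomologicalComplex.Represents.smul r h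
  rwa [← map_smul] at this

lemma ExtRep.sub {f f' : P.complex.X n ⟶ Y}
    {e e' : ((Ext A (ModuleCat.{u} A) n).obj (op X)).obj Y}
    (h : P.ExtRep f e) (h' : P.ExtRep f' e') : P.ExtRep (f - f') (e - e') := by
  simpa [sub_eq_add_neg] using h.add (h'.smul (-1))

lemma ExtRep.d_comp {f : P.complex.X n ⟶ Y}
    {e : ((Ext A (ModuleCat.{u} A) n).obj (op X)).obj Y}
    (h : P.ExtRep f e) (j : ℕ) : P.complex.d j n ≫ f = 0 :=
  HomologicalComplex.Represents.d_apply_eq_zero h j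

variable (P) in
lemma exists_extRep (e : ((Ext A (ModuleCat.{u} A) n).obj (op X)).obj Y) :
    ∃ f : P.complex.X n ⟶ Y, P.ExtRep f e :=
  HomologicalComplex.exists_represents (P.extEquiv Y n e)

lemma exists_extRep_of_d_comp_eq_zero {f : P.complex.X n ⟶ Y}
    (hf : P.complex.d (n + 1) n ≫ f = 0) :
    ∃ e : ((Ext A (ModuleCat.{u} A) n).obj (op X)).obj Y, P.ExtRep f e := by
  obtain ⟨e, he⟩ := HomologicalComplex.exists_represents_of_d_apply_eq_zero
    (K := P.homComplex Y) (i := n) (x := f) (ChainComplex.prev ℕ n) hf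
  obtain ⟨e, rfl⟩ := (P.extEquiv Y n).surjective e
  exact ⟨e, he⟩

variable (P) in
lemma extRep_d_comp_zero {j : ℕ} (g : P.complex.X j ⟶ Y) :
    P.ExtRep (n := n) (P.complex.d n j ≫ g) 0 := by
  have := HomologicalComplex.represents_d_zero (K := P.homComplex Y) (i := n) (j := j) g
  rwa [← map_zero (P.extEquiv Y n)] at this

lemma ExtRep.exists_d_comp_eq {f : P.complex.X n ⟶ Y} (h : P.ExtRep f 0) :
    ∃ g, P.complex.d n ((ComplexShape.down ℕ).next n) ≫ g = f := by
  have h : (P.homComplex Y).Represents (i := n) f 0 := map_zero (P.extEquiv Y n) ▸ h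
  exact h.exists_d_eq rfl

lemma ExtRep.unique {f : P.complex.X n ⟶ Y}
    {e e' : ((Ext A (ModuleCat.{u} A) n).obj (op X)).obj Y}
    (h : P.ExtRep f e) (h' : P.ExtRep f e') : e = e' :=
  (P.extEquiv Y n).injective (HomologicalComplex.Represents.unique h h')

lemma ExtRep.precomp {P' : ProjectiveResolution X'} (φ : P'.complex ⟶ P.complex) (u : X' ⟶ X)
    (hφ : φ.f 0 ≫ P.π.f 0 = P'.π.f 0 ≫ u) {f : P.complex.X n ⟶ Y}
    {e : ((Ext A (ModuleCat.{u} A) n).obj (op X)).obj Y} (h : P.ExtRep f e) :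
    P'.ExtRep (φ.f n ≫ f) ((((Ext A (ModuleCat.{u} A) n).map u.op).app Y).hom e) := by
  have := HomologicalComplex.Represents.map (K := P.homComplex Y) (L := P'.homComplex Y)
    ((((linearYoneda A (ModuleCat.{u} A)).obj Y).rightOp.mapHomologicalComplex _).map φ) h
  refine Eq.mp ?_ this
  refine congrArg (HomologicalComplex.Represents (K := P'.homComplex Y) (i := n) (φ.f n ≫ f)) ?_
  exact congr($(congrArg Quiver.Hom.unop (isoLeftDerivedObj_inv_naturality u P' P φ hφ
    ((linearYoneda A (ModuleCat.{u} A)).obj Y).rightOp n)).hom e).symm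

end CategoryTheory.ProjectiveResolution

namespace ModuleCat

variable {R : Type u} [CommRing R] (S : Submonoid R)

lemma localizedModuleFunctor_map_smul {X Y : ModuleCat.{u} R} (r : R) (f : X ⟶ Y) :
    (localizedModuleFunctor S).map (r • f) =
      algebraMap R (Localization S) r • (localizedModuleFunctor S).map f := by
  ext x
  change IsLocalizedModule.mapExtendScalars S (X.localizedModuleMkLinearMap S)
    (Y.localizedModuleMkLinearMap S) (Localization S) (r • f.hom) x =
      algebraMap R (Localization S) r • IsLocalizedModule.mapExtendScalars S
        (X.localizedModuleMkLinearMap S) (Y.localizedModuleMkLinearMap S) (Localization S) f.hom x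
  rw [map_smul, algebraMap_smul]
  rfl

lemma exists_localizedModuleFunctor_map_eq_smul {X Y : ModuleCat.{u} R}
    [Module.FinitePresentation R X]
    (f' : (localizedModuleFunctor S).obj X ⟶ (localizedModuleFunctor S).obj Y) :
    ∃ (s : S) (f : X ⟶ Y), (localizedModuleFunctor S).map f =
      algebraMap R (Localization S) s • f' := by
  obtain ⟨⟨f, s⟩, h⟩ := IsLocalizedModule.surj S (IsLocalizedModule.mapExtendScalars S
    (X.localizedModuleMkLinearMap S) (Y.localizedModuleMkLinearMap S) (Localization S)) f'.hom
  refine ⟨s, ofHom f, ?_⟩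
  ext x
  exact congr($h x).symm.trans
    (algebraMap_smul (Localization S) (s : R) (M := Y.localizedModule S) (f'.hom x)).symm

lemma exists_smul_eq_zero_of_localizedModuleFunctor_map_eq_zero {X Y : ModuleCat.{u} R}
    [Module.FinitePresentation R X] {f : X ⟶ Y} (hf : (localizedModuleFunctor S).map f = 0) :
    ∃ s : S, (s : R) • f = 0 := by
  obtain ⟨s, hs⟩ := (IsLocalizedModule.eq_zero_iff S (IsLocalizedModule.mapExtendScalars S
    (X.localizedModuleMkLinearMap S) (Y.localizedModuleMkLinearMap S) (Localization S))).1
      (congrArg Hom.hom hf)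
  exact ⟨s, hom_ext hs⟩

end ModuleCat

namespace CategoryTheory.ProjectiveResolution

open ModuleCat

variable {R : Type u} [CommRing R] (S : Submonoid R) {X X' Y : ModuleCat.{u} R} {n : ℕ}

/-- The localization of a projective resolution. -/
noncomputable abbrev localize (P : ProjectiveResolution X) :
    ProjectiveResolution ((localizedModuleFunctor S).obj X) :=
  (localizedModuleFunctor S).mapProjectiveResolution P

variable (P : ProjectiveResolution X)

lemma ExtRep.exists_localize {f : P.complex.X n ⟶ Y}
    {e : ((Ext R (ModuleCat.{u} R) n).obj (op X)).obj Y} (h : P.ExtRep f e) :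
    ∃ e' : ((Ext (Localization S) (ModuleCat.{u} (Localization S)) n).obj
      (op ((localizedModuleFunctor S).obj X))).obj ((localizedModuleFunctor S).obj Y),
      (P.localize S).ExtRep ((localizedModuleFunctor S).map f) e' := by
  apply exists_extRep_of_d_comp_eq_zero
  change (localizedModuleFunctor S).map _ ≫ (localizedModuleFunctor S).map _ = 0
  rw [← Functor.map_comp, h.d_comp, Functor.map_zero]

/-- The localization of an Ext class: the class of a cocycle `f` is sent to the class of the
localization of `f`. -/
noncomputable def localizeExtClass (e : ((Ext R (ModuleCat.{u} R) n).obj (op X)).obj Y) :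
    ((Ext (Localization S) (ModuleCat.{u} (Localization S)) n).obj
      (op ((localizedModuleFunctor S).obj X))).obj ((localizedModuleFunctor S).obj Y) :=
  ((P.exists_extRep e).choose_spec.exists_localize S).choose

variable {P}

lemma ExtRep.localize {f : P.complex.X n ⟶ Y}
    {e : ((Ext R (ModuleCat.{u} R) n).obj (op X)).obj Y} (h : P.ExtRep f e) :
    (P.localize S).ExtRep ((localizedModuleFunctor S).map f) (P.localizeExtClass S e) := by
  have h₀ := (P.exists_extRep e).choose_spec
  have h₁ : (P.localize S).ExtRep _ (P.localizeExtClass S e) := (h₀.exists_localize S).choose_spec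
  obtain ⟨g, hg⟩ : ∃ g, P.complex.d n ((ComplexShape.down ℕ).next n) ≫ g =
      f - (P.exists_extRep e).choose := by
    have := h.sub h₀
    rw [sub_self] at this
    exact this.exists_d_comp_eq
  have h₂ := (P.localize S).extRep_d_comp_zero (n := n) ((localizedModuleFunctor S).map g)
  have := h₁.add h₂
  rw [add_zero] at this
  refine (congrArg (fun k ↦ (P.localize S).ExtRep k _) ?_).mpr this
  exact sub_eq_iff_eq_add'.1 ((Functor.map_sub _).symm.trans
    ((congrArg (localizedModuleFunctor S).map hg.symm).trans (Functor.map_comp _ _ _)))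

variable (P) in
/-- `localizeExtClass` as a semilinear map. -/
noncomputable def localizeExt (Y : ModuleCat.{u} R) (n : ℕ) :
    ((Ext R (ModuleCat.{u} R) n).obj (op X)).obj Y →ₛₗ[algebraMap R (Localization S)]
      ((Ext (Localization S) (ModuleCat.{u} (Localization S)) n).obj
        (op ((localizedModuleFunctor S).obj X))).obj ((localizedModuleFunctor S).obj Y) where
  toFun := P.localizeExtClass S
  map_add' e e' := by
    obtain ⟨f, hf⟩ := P.exists_extRep e
    obtain ⟨f', hf'⟩ := P.exists_extRep e'
    have := (hf.add hf').localize S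
    rw [Functor.map_add] at this
    exact this.unique ((hf.localize S).add (hf'.localize S))
  map_smul' r e := by
    obtain ⟨f, hf⟩ := P.exists_extRep e
    have := (hf.smul r).localize S
    rw [localizedModuleFunctor_map_smul] at this
    exact this.unique ((hf.localize S).smul _)

lemma localizeExt_naturality {P' : ProjectiveResolution X'} (u : X' ⟶ X)
    (e : ((Ext R (ModuleCat.{u} R) n).obj (op X)).obj Y) :
    P'.localizeExt S Y n ((((Ext R (ModuleCat.{u} R) n).map u.op).app Y).hom e) =
      (((Ext (Localization S) (ModuleCat.{u} (Localization S)) n).map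
        ((localizedModuleFunctor S).map u).op).app ((localizedModuleFunctor S).obj Y)).hom
        (P.localizeExt S Y n e) := by
  obtain ⟨f, hf⟩ := P.exists_extRep e
  have h₁ := (hf.precomp (lift u P' P) u (lift_commutes_zero _ _ _)).localize S
  rw [Functor.map_comp] at h₁
  refine h₁.unique ((hf.localize S).precomp (P := P.localize S) (P' := P'.localize S)
    (((localizedModuleFunctor S).mapHomologicalComplex _).map (lift u P' P))
    ((localizedModuleFunctor S).map u) ?_)
  have hπ := congrArg ((localizedModuleFunctor S).mapHomologicalComplex _).map
    (lift_commutes u P' P)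
  rw [Functor.map_comp, Functor.map_comp] at hπ
  have hsingle := (HomologicalComplex.singleMapHomologicalComplex
    (localizedModuleFunctor S) (ComplexShape.down ℕ) 0).hom.naturality u
  have hcomm := (reassoc_of% hπ) _ |>.trans
    (congrArg (((localizedModuleFunctor S).mapHomologicalComplex _).map P'.π ≫ ·) hsingle)
  exact (HomologicalComplex.congr_hom hcomm 0).trans ((Category.assoc _ _ _).symm.trans
    (congrArg (((P'.localize S).π.f 0) ≫ ·) (ChainComplex.single₀_map_f_zero _)))

lemma exists_localizeExt_eq_smul [Module.FinitePresentation R (P.complex.X n)]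
    [Module.FinitePresentation R (P.complex.X (n + 1))]
    (e' : ((Ext (Localization S) (ModuleCat.{u} (Localization S)) n).obj
        (op ((localizedModuleFunctor S).obj X))).obj ((localizedModuleFunctor S).obj Y)) :
    ∃ (s : S) (e : ((Ext R (ModuleCat.{u} R) n).obj (op X)).obj Y),
      P.localizeExt S Y n e = algebraMap R (Localization S) s • e' := by
  obtain ⟨f', hf'⟩ := (P.localize S).exists_extRep e'
  obtain ⟨s, f, hf⟩ := exists_localizedModuleFunctor_map_eq_smul S f'
  obtain ⟨t, ht⟩ := exists_smul_eq_zero_of_localizedModuleFunctor_map_eq_zero S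
    (f := P.complex.d (n + 1) n ≫ f) (by
      rw [Functor.map_comp, hf]
      exact (hf'.smul _).d_comp (n + 1))
  obtain ⟨e, he⟩ := exists_extRep_of_d_comp_eq_zero (P := P) (f := (t : R) • f)
    (by rw [Linear.comp_smul, ht])
  refine ⟨t * s, e, (he.localize S).unique ?_⟩
  have heq : (localizedModuleFunctor S).map ((t : R) • f) =
      algebraMap R (Localization S) (t * s : S) • f' := by
    rw [localizedModuleFunctor_map_smul, hf, Submonoid.coe_mul, map_mul]
    exact smul_smul _ _ f'
  exact (congrArg (fun k ↦ (P.localize S).ExtRep k _) heq).mpr (hf'.smul _)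

end CategoryTheory.ProjectiveResolution

namespace FGModuleCat

variable {R : Type u} [CommRing R]

/-- Every object of `FGModuleCat R` is a quotient of a finite free module. -/
lemma exists_epi_of_pi (X : FGModuleCat.{u} R) :
    ∃ (n : ℕ) (f : of R (Fin n → R) ⟶ X), Epi f := by
  obtain ⟨n, f, hf⟩ := Module.Finite.exists_fin' R X
  refine ⟨n, ofHom f, ?_⟩
  exact ConcreteCategory.epi_of_surjective _ hf

variable [IsNoetherianRing R]

lemma projective_of_pi (n : ℕ) : Projective (of R (Fin n → R)) where
  factors f e _ := by
    let F := forget₂ (FGModuleCat.{u} R) (ModuleCat.{u} R)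
    exact ⟨F.preimage (Projective.factorThru (P := ModuleCat.of R (Fin n → R)) (F.map f) (F.map e)),
      F.map_injective (by simp)⟩

instance : EnoughProjectives (FGModuleCat.{u} R) where
  presentation X := by
    obtain ⟨n, f, hf⟩ := exists_epi_of_pi X
    exact ⟨{ p := of R (Fin n → R), f := f, projective := projective_of_pi n }⟩

instance : (forget₂ (FGModuleCat.{u} R) (ModuleCat.{u} R)).PreservesProjectiveObjects where
  projective_obj {X} hX := by
    obtain ⟨n, f, hf⟩ := exists_epi_of_pi X
    let r : Retract X (of R (Fin n → R)) := ⟨Projective.factorThru (𝟙 X) f, f, by simp⟩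
    exact (r.map (forget₂ (FGModuleCat.{u} R) (ModuleCat.{u} R))).projective
      (p := (inferInstance : Projective (ModuleCat.of R (Fin n → R))))

end FGModuleCat

lemma ModuleCat.exists_projectiveResolution_finite {R : Type u} [CommRing R] [IsNoetherianRing R]
    (X : ModuleCat.{u} R) [Module.Finite R X] :
    ∃ P : ProjectiveResolution X, ∀ n, Module.Finite R (P.complex.X n) :=
  ⟨(forget₂ (FGModuleCat.{u} R) (ModuleCat.{u} R)).mapProjectiveResolution
    (CategoryTheory.projectiveResolution (FGModuleCat.of R X)), fun n ↦
      ((CategoryTheory.projectiveResolution (FGModuleCat.of R X)).complex.X n).property⟩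

section

variable {R : Type u} [CommRing R] (S : Submonoid R)

lemma Module.finite_of_semilinearMap {H H' : Type*} [AddCommGroup H] [Module R H]
    [AddCommGroup H'] [Module (Localization S) H'] (Φ : H →ₛₗ[algebraMap R (Localization S)] H')
    (hΦ : ∀ y, ∃ (s : S) (x : H), Φ x = algebraMap R (Localization S) s • y)
    {N : Submodule R H} (hN : N.FG) (hNS : ∀ x, ∃ s : S, (s : R) • x ∈ N) :
    Module.Finite (Localization S) H' := by
  obtain ⟨G, rfl⟩ := hN
  refine ⟨Submodule.fg_def.2 ⟨_, G.finite_toSet.image Φ, eq_top_iff.2 fun y _ ↦ ?_⟩⟩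
  have hle : Submodule.span R G ≤ (Submodule.span (Localization S) (Φ '' G)).comap Φ :=
    Submodule.span_le.2 fun x hx ↦ Submodule.subset_span ⟨x, hx, rfl⟩
  obtain ⟨s, x, hx⟩ := hΦ y
  obtain ⟨t, ht⟩ := hNS x
  have := hle ht
  rwa [Submodule.mem_comap, map_smulₛₗ, hx, smul_smul, ← map_mul, ← Submonoid.coe_mul,
    Submodule.smul_mem_iff_of_isUnit _ (IsLocalization.map_units (Localization S) (t * s))] at this

namespace ModuleCat

/-- The comparison map `S⁻¹R/J ⟶ S⁻¹(R/I)`, where `J` is the extension of `I`. -/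
noncomputable def quotientToLocalizedModule (I : Ideal R) {J : Ideal (Localization S)}
    (h : J = I.map (algebraMap R (Localization S))) :
    of (Localization S) (Localization S ⧸ J) ⟶ (localizedModuleFunctor S).obj (of R (R ⧸ I)) :=
  ofHom <| Submodule.liftQ J (LinearMap.toSpanSingleton (Localization S)
    ((of R (R ⧸ I)).localizedModule S) ((of R (R ⧸ I)).localizedModuleMkLinearMap S
      (Ideal.Quotient.mk I 1))) <| by
    rw [h, Ideal.map, Submodule.span_le]
    rintro _ ⟨r, hr, rfl⟩
    change algebraMap R (Localization S) r • (of R (R ⧸ I)).localizedModuleMkLinearMap S _ = 0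
    rw [algebraMap_smul, ← map_smul, ← map_zero ((of R (R ⧸ I)).localizedModuleMkLinearMap S)]
    congr 1
    exact (Ideal.Quotient.eq_zero_iff_mem.2 (by simpa using hr) :
      Ideal.Quotient.mk I (r * 1) = 0)

lemma quotientToLocalizedModule_algebraMap (I : Ideal R) {J : Ideal (Localization S)}
    (h : J = I.map (algebraMap R (Localization S))) (r : R) :
    (quotientToLocalizedModule S I h).hom (Ideal.Quotient.mk J (algebraMap R _ r)) =
      (of R (R ⧸ I)).localizedModuleMkLinearMap S (Ideal.Quotient.mk I r) := by
  change algebraMap R (Localization S) r • (of R (R ⧸ I)).localizedModuleMkLinearMap S _ = _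
  rw [algebraMap_smul, ← map_smul]
  congr 1
  exact congrArg (Ideal.Quotient.mk I) (mul_one r)

lemma bijective_quotientToLocalizedModule (I : Ideal R) {J : Ideal (Localization S)}
    (h : J = I.map (algebraMap R (Localization S))) :
    Function.Bijective (quotientToLocalizedModule S I h).hom := by
  constructor
  · refine (injective_iff_map_eq_zero _).2 fun x hx ↦ ?_
    obtain ⟨z, rfl⟩ := Ideal.Quotient.mk_surjective x
    obtain ⟨⟨r, s⟩, hrs⟩ := IsLocalization.surj S z
    have hr : (of R (R ⧸ I)).localizedModuleMkLinearMap S (Ideal.Quotient.mk I r) = 0 := by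
      rw [← quotientToLocalizedModule_algebraMap S I h, ← hrs, mul_comm]
      exact (map_smul (quotientToLocalizedModule S I h).hom (algebraMap R (Localization S) s)
        (Ideal.Quotient.mk J z)).trans ((congrArg _ hx).trans (smul_zero _))
    obtain ⟨c, hc⟩ := (localizedModule_isLocalizedModule (of R (R ⧸ I)) S).exists_of_eq
      (hr.trans (map_zero _).symm)
    have hcI : (c : R) * r ∈ I :=
      Ideal.Quotient.eq_zero_iff_mem.1 (hc.trans (smul_zero (c : R)))
    have hcJ : algebraMap R (Localization S) (c * s : S) * z ∈ J := by
      rw [h, Submonoid.coe_mul, map_mul, mul_assoc, mul_comm _ z, hrs, ← map_mul]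
      exact Ideal.mem_map_of_mem _ hcI
    exact Ideal.Quotient.eq_zero_iff_mem.2
      ((Ideal.unit_mul_mem_iff_mem _ (IsLocalization.map_units _ _)).1 hcJ)
  · intro y
    obtain ⟨⟨m, s⟩, hms⟩ := (localizedModule_isLocalizedModule (of R (R ⧸ I)) S).surj y
    obtain ⟨r, rfl⟩ := Ideal.Quotient.mk_surjective m
    obtain ⟨u, hu⟩ := IsLocalization.map_units (Localization S) s
    refine ⟨((u⁻¹ : (Localization S)ˣ) : Localization S) •
      Ideal.Quotient.mk J (algebraMap R _ r), ?_⟩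
    have hsy : algebraMap R (Localization S) s • y =
        (of R (R ⧸ I)).localizedModuleMkLinearMap S (Ideal.Quotient.mk I r) :=
      (algebraMap_smul (Localization S) (s : R) (M := (of R (R ⧸ I)).localizedModule S) y).trans hms
    rw [map_smul, quotientToLocalizedModule_algebraMap, ← hsy, ← hu, smul_smul, Units.inv_mul,
      one_smul]

instance (I : Ideal R) {J : Ideal (Localization S)}
    (h : J = I.map (algebraMap R (Localization S))) : IsIso (quotientToLocalizedModule S I h) :=
  (ConcreteCategory.isIso_iff_bijective _).2 (bijective_quotientToLocalizedModule S I h)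

lemma quotientToLocalizedModule_naturality {I I' : Ideal R} {J J' : Ideal (Localization S)}
    (h : J = I.map (algebraMap R (Localization S)))
    (h' : J' = I'.map (algebraMap R (Localization S))) (hI : I ≤ I') (hJ : J ≤ J') :
    quotientToLocalizedModule S I h ≫ (localizedModuleFunctor S).map
      (ofHom (Submodule.mapQ I I' LinearMap.id hI)) =
    ofHom (Submodule.mapQ J J' LinearMap.id hJ) ≫ quotientToLocalizedModule S I' h' := by
  apply hom_ext
  apply Submodule.linearMap_qext
  apply LinearMap.ext_ring
  have h₁ : ∀ J : Ideal (Localization S), (Submodule.mkQ J) 1 =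
      Ideal.Quotient.mk J (algebraMap R _ 1) := fun J ↦
    (congrArg (Ideal.Quotient.mk J) (map_one (algebraMap R _))).symm
  change (localizedModuleMap S _).hom ((quotientToLocalizedModule S I h).hom (J.mkQ 1)) =
    (quotientToLocalizedModule S I' h').hom (J'.mkQ 1)
  rw [h₁, h₁, quotientToLocalizedModule_algebraMap, quotientToLocalizedModule_algebraMap]
  have := localizedModule_isLocalizedModule (of R (R ⧸ I)) S
  have := localizedModule_isLocalizedModule (of R (R ⧸ I')) S
  exact IsLocalizedModule.map_apply S _ _ _ _

end ModuleCat

end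

namespace localCohomology

open ModuleCat ProjectiveResolution

variable {R : Type u} [CommRing R]

/-- The cocone exhibiting `H^j_a(M)` as the colimit of the modules `Ext^j(R/a^t, M)`. -/
noncomputable abbrev coconeAt (a : Ideal R) (j : ℕ) (M : ModuleCat.{u} R) :
    Cocone (diagram (idealPowersDiagram a) j ⋙ (evaluation _ _).obj M) :=
  ((evaluation _ _).obj M).mapCocone (colimit.cocone (diagram (idealPowersDiagram a) j))

/-- `coconeAt` is a colimit cocone. -/
noncomputable def isColimitCoconeAt (a : Ideal R) (j : ℕ) (M : ModuleCat.{u} R) :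
    IsColimit (coconeAt a j M) :=
  isColimitOfPreserves ((evaluation _ _).obj M) (colimit.isColimit _)

lemma exists_coconeAt_ι_eq (a : Ideal R) (j : ℕ) (M : ModuleCat.{u} R)
    (x : (localCohomology a j).obj M) :
    ∃ t e, ((coconeAt a j M).ι.app t).hom e = x :=
  have : PreservesFilteredColimitsOfSize.{0, 0} (forget (ModuleCat.{u} R)) :=
    preservesFilteredColimitsOfSize_shrink.{0, u, 0, u} _
  Concrete.isColimit_exists_rep _ (isColimitCoconeAt a j M) x

variable [IsNoetherianRing R] (S : Submonoid R)

/-- A resolution of `R/I` by finite projective modules. -/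
noncomputable def quotientResolution (I : Ideal R) : ProjectiveResolution (of R (R ⧸ I)) :=
  ((of R (R ⧸ I)).exists_projectiveResolution_finite).choose

instance (I : Ideal R) (n : ℕ) : Module.Finite R ((quotientResolution I).complex.X n) :=
  ((of R (R ⧸ I)).exists_projectiveResolution_finite).choose_spec n

/-- The localization map from `Ext^j(R/I, M)` to `Ext^j(S⁻¹R/J, S⁻¹M)`, where `J` is the
extension of `I`. -/
noncomputable def localizeExtQuotient (I : Ideal R) {J : Ideal (Localization S)}
    (h : J = I.map (algebraMap R (Localization S))) (M : ModuleCat.{u} R) (j : ℕ) :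
    ((Ext R (ModuleCat.{u} R) j).obj (op (of R (R ⧸ I)))).obj M →ₛₗ[algebraMap R (Localization S)]
      ((Ext (Localization S) (ModuleCat.{u} (Localization S)) j).obj
        (op (of _ (Localization S ⧸ J)))).obj ((localizedModuleFunctor S).obj M) :=
  (((Ext (Localization S) (ModuleCat.{u} (Localization S)) j).map
    (quotientToLocalizedModule S I h).op).app ((localizedModuleFunctor S).obj M)).hom.comp
    ((quotientResolution I).localizeExt S M j)

lemma exists_localizeExtQuotient_eq_smul (I : Ideal R) {J : Ideal (Localization S)}
    (h : J = I.map (algebraMap R (Localization S))) (M : ModuleCat.{u} R) (j : ℕ)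
    (e' : ((Ext (Localization S) (ModuleCat.{u} (Localization S)) j).obj
        (op (of _ (Localization S ⧸ J)))).obj ((localizedModuleFunctor S).obj M)) :
    ∃ (s : S) (e : _), localizeExtQuotient S I h M j e =
      algebraMap R (Localization S) s • e' := by
  obtain ⟨e', rfl⟩ := (ConcreteCategory.bijective_of_isIso
    (((Ext (Localization S) (ModuleCat.{u} (Localization S)) j).map
    (quotientToLocalizedModule S I h).op).app ((localizedModuleFunctor S).obj M))).surjective e'
  have (n : ℕ) : Module.FinitePresentation R ((quotientResolution I).complex.X n) :=
    Module.finitePresentation_of_finite R _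
  obtain ⟨s, e, he⟩ := exists_localizeExt_eq_smul S (P := quotientResolution I) e'
  refine ⟨s, e, ?_⟩
  exact (congrArg (((Ext (Localization S) (ModuleCat.{u} (Localization S)) j).map
    (quotientToLocalizedModule S I h).op).app ((localizedModuleFunctor S).obj M)).hom he).trans
      (map_smul _ _ _)

lemma localizeExtQuotient_naturality {I I' : Ideal R} {J J' : Ideal (Localization S)}
    (h : J = I.map (algebraMap R (Localization S)))
    (h' : J' = I'.map (algebraMap R (Localization S))) (hI : I ≤ I') (hJ : J ≤ J')
    (M : ModuleCat.{u} R) (j : ℕ)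
    (e : ((Ext R (ModuleCat.{u} R) j).obj (op (of R (R ⧸ I')))).obj M) :
    localizeExtQuotient S I h M j ((((Ext R (ModuleCat.{u} R) j).map
      (ofHom (Submodule.mapQ I I' LinearMap.id hI)).op).app M).hom e) =
    (((Ext (Localization S) (ModuleCat.{u} (Localization S)) j).map
      (ofHom (Submodule.mapQ J J' LinearMap.id hJ)).op).app _).hom
      (localizeExtQuotient S I' h' M j e) := by
  refine (congrArg _ (localizeExt_naturality S (P := quotientResolution I')
    (P' := quotientResolution I) _ e)).trans ?_
  have := congrArg (fun k ↦ ((Ext (Localization S) (ModuleCat.{u} (Localization S)) j).map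
    k.op).app ((localizedModuleFunctor S).obj M))
    (quotientToLocalizedModule_naturality S h h' hI hJ)
  simp only [op_comp, Functor.map_comp, NatTrans.comp_app] at this
  exact congr($(this).hom ((quotientResolution I').localizeExt S M j e))

lemma exists_semilinearMap (a : Ideal R) (M : ModuleCat.{u} R) (j : ℕ) :
    ∃ Φ : (localCohomology a j).obj M →ₛₗ[algebraMap R (Localization S)]
      (localCohomology (a.map (algebraMap R (Localization S))) j).obj
        ((localizedModuleFunctor S).obj M),
      ∀ y, ∃ (s : S) (x : _), Φ x = algebraMap R (Localization S) s • y := by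
  have h (t : ℕ) : (a.map (algebraMap R (Localization S))) ^ t =
    (a ^ t).map (algebraMap R (Localization S)) := (Ideal.map_pow _ _ _).symm
  let c' := coconeAt (a.map (algebraMap R (Localization S))) j ((localizedModuleFunctor S).obj M)
  let ψ (t : (ℕᵒᵖ)ᵒᵖ) := (c'.ι.app t).hom.comp (localizeExtQuotient S _ (h t.unop.unop) M j)
  let c : Cocone (diagram (idealPowersDiagram a) j ⋙ (evaluation _ _).obj M) :=
    { pt := (restrictScalars (algebraMap R (Localization S))).obj c'.pt
      ι :=
      { app t := semilinearMapAddEquiv _ _ _ (ψ t)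
        naturality t t' w := by
          ext e
          refine (congrArg (c'.ι.app t').hom (localizeExtQuotient_naturality S (h _) (h _)
            _ (Ideal.pow_le_pow_right w.unop.unop.le) M j e)).trans ?_
          exact congr($(c'.w w).hom (localizeExtQuotient S _ (h t.unop.unop) M j e)) } }
  let Φ := (semilinearMapAddEquiv _ _ _).symm ((isColimitCoconeAt a j M).desc c)
  refine ⟨Φ, fun y ↦ ?_⟩
  obtain ⟨t, e', rfl⟩ := exists_coconeAt_ι_eq _ _ _ y
  obtain ⟨s, e, he⟩ := exists_localizeExtQuotient_eq_smul S _ (h t.unop.unop) M j e'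
  refine ⟨s, ((coconeAt a j M).ι.app t).hom e, ?_⟩
  refine (congr($((isColimitCoconeAt a j M).fac c t).hom e)).trans ?_
  exact (congrArg (c'.ι.app t).hom he).trans (map_smul (c'.ι.app t).hom _ _)

end localCohomology

section

variable {R : Type u} [CommRing R]

lemma Module.krullDim_quotient_le_krullDim_support {H : Type*} [AddCommGroup H] [Module R H]
    {p : PrimeSpectrum R} (hp : p ∈ Module.support R H) :
    ringKrullDim (R ⧸ p.asIdeal) ≤ Order.krullDim (Module.support R H) := by
  rw [ringKrullDim_quotient]
  exact Order.krullDim_le_of_strictMono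
    (fun q ↦ ⟨q.1, Module.mem_support_mono (PrimeSpectrum.mem_zeroLocus _ _ |>.1 q.2) hp⟩)
    fun _ _ h ↦ h

lemma InDimLT.finite_localCohomology_localizedModule [IsNoetherianRing R] {M : Type u}
    [AddCommGroup M] [Module R M] {a : Ideal R} {n j : ℕ}
    (h : InDimLT R ((localCohomology a j).obj (ModuleCat.of R M)) n) {p : PrimeSpectrum R}
    (hp : n ≤ ringKrullDim (R ⧸ p.asIdeal)) :
    Module.Finite (Localization.AtPrime p.asIdeal)
      ((localCohomology (a.map (algebraMap R (Localization.AtPrime p.asIdeal))) j).obj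
        (ModuleCat.of _ (LocalizedModule p.asIdeal.primeCompl M))) := by
  obtain ⟨N, hN, hdim⟩ := h
  have hpN : p ∉ Module.support R (_ ⧸ N) := fun hmem ↦
    (hp.trans (Module.krullDim_quotient_le_krullDim_support hmem)).not_gt hdim
  obtain ⟨Φ, hΦ⟩ := localCohomology.exists_semilinearMap p.asIdeal.primeCompl a (.of R M) j
  have := Module.finite_of_semilinearMap _ Φ hΦ hN fun x ↦ by
    obtain ⟨r, hr, hrx⟩ := Module.notMem_support_iff'.1 hpN (N.mkQ x)
    exact ⟨⟨r, hr⟩, (Submodule.Quotient.mk_eq_zero N).1 hrx⟩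
  exact (Module.Finite.equiv_iff ((localCohomology _ j).mapIso
    (Shrink.linearEquiv.{u} (Localization p.asIdeal.primeCompl)
      (LocalizedModule p.asIdeal.primeCompl M)).toModuleIso).toLinearEquiv).1 this

end

theorem hDim_le_fDimN (R M : Type u) [CommRing R] [IsNoetherianRing R]
    [AddCommGroup M] [Module R M] [Module.Finite R M] (a : Ideal R) (n : ℕ) :
    hDim R a M n ≤ fDimN R a M n := by
  refine le_sInf ?_
  rintro _ ⟨p, -, hp, rfl⟩
  refine le_sInf ?_
  rintro _ ⟨j, rfl, hj⟩
  exact sInf_le ⟨j, rfl, fun h ↦ hj (h.finite_localCohomology_localizedModule hp)⟩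
end

section
/- Let (R, m) be a complete Noetherian local ring, a an ideal of R, M a finitely generated R-module, and n a nonnegative integer. Then f^n_a(M) = h^n_a(M), i.e., the infimum over primes p ∈ Supp(M/aM) with dim R/p ≥ n of the finiteness dimensions f_{aR_p}(M_p) equals the least integer i such that H^i_a(M) is not in dimension < n. -/
open CategoryTheory

universe u

namespace CategoryTheory.Functor

open Limits

universe v₁ v₂ u₁ u₂
variable {C : Type u₁} [Category.{v₁} C] [Abelian C]
  {D : Type u₂} [Category.{v₂} D] [Abelian D]
  {F₁ F₂ F₃ : C ⥤ D} [F₁.Additive] [F₂.Additive] [F₃.Additive] (α : F₁ ⟶ F₂) (β : F₂ ⟶ F₃)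
  (w : ∀ X, α.app X ≫ β.app X = 0)

/-- The short complex of chain complexes obtained by evaluating a complex of additive functors
on a chain complex. -/
noncomputable abbrev evalShortComplex (K : ChainComplex C ℕ) : ShortComplex (ChainComplex D ℕ) where
  X₁ := (F₁.mapHomologicalComplex _).obj K
  X₂ := (F₂.mapHomologicalComplex _).obj K
  X₃ := (F₃.mapHomologicalComplex _).obj K
  f := (NatTrans.mapHomologicalComplex α _).app K
  g := (NatTrans.mapHomologicalComplex β _).app K
  zero := by ext; exact w _

/-- `evalShortComplex` is functorial in the chain complex. -/
noncomputable abbrev evalShortComplexMap {K L : ChainComplex C ℕ} (φ : K ⟶ L) :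
    evalShortComplex α β w K ⟶ evalShortComplex α β w L where
  τ₁ := (F₁.mapHomologicalComplex _).map φ
  τ₂ := (F₂.mapHomologicalComplex _).map φ
  τ₃ := (F₃.mapHomologicalComplex _).map φ
  comm₁₂ := (NatTrans.mapHomologicalComplex α _).naturality φ
  comm₂₃ := (NatTrans.mapHomologicalComplex β _).naturality φ

variable (h : ∀ X [Projective X], (ShortComplex.mk _ _ (w X)).ShortExact)

include h in
lemma shortExact_evalShortComplex {X : C} (P : ProjectiveResolution X) :
    (evalShortComplex α β w P.complex).ShortExact :=
  HomologicalComplex.shortExact_of_degreewise_shortExact _ fun i => h (P.complex.X i)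

variable [EnoughProjectives C]

/-- A left derived functor as the homology of the chosen projective resolution. -/
noncomputable def leftDerivedIsoHomology (F : C ⥤ D) [F.Additive] (n : ℕ) (X : C) :
    (F.leftDerived n).obj X ≅
      ((F.mapHomologicalComplex _).obj (projectiveResolution X).complex).homology n :=
  (projectiveResolution X).isoLeftDerivedObj F n

lemma leftDerivedIsoHomology_hom_naturality (F : C ⥤ D) [F.Additive] (n : ℕ) {X Y : C}
    (f : X ⟶ Y) :
    (F.leftDerived n).map f ≫ (leftDerivedIsoHomology F n Y).hom =
      (leftDerivedIsoHomology F n X).hom ≫ HomologicalComplex.homologyMap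
        ((F.mapHomologicalComplex _).map (ProjectiveResolution.lift f
          (projectiveResolution X) (projectiveResolution Y))) n :=
  ProjectiveResolution.isoLeftDerivedObj_hom_naturality f _ _ _
    (ProjectiveResolution.lift_commutes_zero f _ _) F n

lemma leftDerivedIsoHomology_inv_naturality (F : C ⥤ D) [F.Additive] (n : ℕ) {X Y : C}
    (f : X ⟶ Y) :
    (leftDerivedIsoHomology F n X).inv ≫ (F.leftDerived n).map f =
      HomologicalComplex.homologyMap
        ((F.mapHomologicalComplex _).map (ProjectiveResolution.lift f
          (projectiveResolution X) (projectiveResolution Y))) n ≫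
      (leftDerivedIsoHomology F n Y).inv := by
  rw [Iso.inv_comp_eq, ← Category.assoc, ← leftDerivedIsoHomology_hom_naturality]
  simp

lemma leftDerived_app_eq {F G : C ⥤ D} [F.Additive] [G.Additive] (α : F ⟶ G) (n : ℕ) (X : C) :
    (NatTrans.leftDerived α n).app X = (leftDerivedIsoHomology F n X).hom ≫
      HomologicalComplex.homologyMap ((NatTrans.mapHomologicalComplex α _).app
        (projectiveResolution X).complex) n ≫ (leftDerivedIsoHomology G n X).inv :=
  ProjectiveResolution.leftDerived_app_eq α _ n

/-- The connecting morphism of left derived functors attached to a complex of additive functors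
that is short exact on projective objects. -/
noncomputable def leftDerivedδ (n : ℕ) : F₃.leftDerived (n + 1) ⟶ F₁.leftDerived n where
  app X := (leftDerivedIsoHomology F₃ (n + 1) X).hom ≫
    (shortExact_evalShortComplex α β w h (projectiveResolution X)).δ (n + 1) n (by simp) ≫
    (leftDerivedIsoHomology F₁ n X).inv
  naturality X Y f := by
    have h3 := HomologicalComplex.HomologySequence.δ_naturality
      (evalShortComplexMap α β w (ProjectiveResolution.lift f
          (projectiveResolution X) (projectiveResolution Y)))
      (shortExact_evalShortComplex α β w h _) (shortExact_evalShortComplex α β w h _)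
      (n + 1) n (by simp)
    rw [reassoc_of% leftDerivedIsoHomology_hom_naturality F₃ (n + 1) f, Category.assoc,
      Category.assoc, leftDerivedIsoHomology_inv_naturality, reassoc_of% h3]

lemma isIso_leftDerivedδ_app (n : ℕ) (X : C) (h₁ : IsZero ((F₂.leftDerived (n + 1)).obj X))
    (h₂ : IsZero ((F₂.leftDerived n).obj X)) : IsIso ((leftDerivedδ α β w h n).app X) := by
  have := (shortExact_evalShortComplex α β w h (projectiveResolution X)).isIso_δ (n + 1) n
    (by simp) (h₁.of_iso (leftDerivedIsoHomology F₂ (n + 1) X).symm)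
    (h₂.of_iso (leftDerivedIsoHomology F₂ n X).symm)
  dsimp only [leftDerivedδ]
  infer_instance

lemma mono_leftDerivedδ_app (n : ℕ) (X : C) (h₁ : IsZero ((F₂.leftDerived (n + 1)).obj X)) :
    Mono ((leftDerivedδ α β w h n).app X) := by
  have := (shortExact_evalShortComplex α β w h (projectiveResolution X)).mono_δ (n + 1) n
    (by simp) (h₁.of_iso (leftDerivedIsoHomology F₂ (n + 1) X).symm)
  dsimp only [leftDerivedδ]
  exact inferInstance

lemma leftDerivedδ_comp (n : ℕ) (X : C) :
    (leftDerivedδ α β w h n).app X ≫ (NatTrans.leftDerived α n).app X = 0 := by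
  rw [leftDerived_app_eq]
  have := (shortExact_evalShortComplex α β w h (projectiveResolution X)).δ_comp (n + 1) n
    (by simp)
  dsimp only [leftDerivedδ]
  simp only [Category.assoc, Iso.inv_hom_id_assoc]
  rw [reassoc_of% this]
  simp

lemma exact_leftDerivedδ (n : ℕ) (X : C) :
    (ShortComplex.mk _ _ (leftDerivedδ_comp α β w h n X)).Exact := by
  refine (ShortComplex.exact_iff_of_iso (ShortComplex.isoMk
    (leftDerivedIsoHomology F₃ (n + 1) X) (leftDerivedIsoHomology F₁ n X)
    (leftDerivedIsoHomology F₂ n X) ?_ ?_)).2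
    ((shortExact_evalShortComplex α β w h (projectiveResolution X)).homology_exact₁
      (n + 1) n (by simp))
  · simp [leftDerivedδ]
  · simp [leftDerived_app_eq]

lemma fromLeftDerivedZero_naturality {F G : C ⥤ D} [F.Additive] [G.Additive] (α : F ⟶ G) :
    NatTrans.leftDerived α 0 ≫ G.fromLeftDerivedZero = F.fromLeftDerivedZero ≫ α := by
  ext X
  have e1 (F : C ⥤ D) [F.Additive] : F.fromLeftDerivedZero.app X =
    (leftDerivedIsoHomology F 0 X).hom ≫ (ChainComplex.isoHomologyι₀ _).hom ≫
      (projectiveResolution X).fromLeftDerivedZero' F :=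
    (projectiveResolution X).fromLeftDerivedZero_eq F
  rw [NatTrans.comp_app, NatTrans.comp_app, leftDerived_app_eq, e1, e1]
  simp only [Category.assoc, Iso.inv_hom_id_assoc, Iso.cancel_iso_hom_left]
  rw [HomologicalComplex.isoHomologyι_hom, HomologicalComplex.isoHomologyι_hom,
    HomologicalComplex.homologyι_naturality_assoc]
  congr 1
  rw [← cancel_epi (HomologicalComplex.pOpcycles _ _)]
  simp
  exact (α.naturality ((projectiveResolution X).π.f 0)).symm

lemma isZero_leftDerived_succ_of_preservesHomology (F : C ⥤ D) [F.Additive]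
    [F.PreservesHomology] (n : ℕ) (X : C) : IsZero ((F.leftDerived (n + 1)).obj X) := by
  refine IsZero.of_iso ?_ (leftDerivedIsoHomology F (n + 1) X)
  rw [← HomologicalComplex.exactAt_iff_isZero_homology]
  have := (projectiveResolution X).complex_exactAt_succ n
  rw [HomologicalComplex.exactAt_iff] at this ⊢
  exact this.map F

end CategoryTheory.Functor

namespace localCohomology

open Opposite Limits
variable {R : Type u} [CommRing R]

/-- The contravariant hom functor into `Y`, viewed as a covariant functor to the opposite
category of modules. -/
noncomputable abbrev homOp (Y : ModuleCat.{u} R) : ModuleCat.{u} R ⥤ (ModuleCat.{u} R)ᵒᵖ :=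
  ((linearYoneda R (ModuleCat.{u} R)).obj Y).rightOp

noncomputable abbrev homOpMap {Y Z : ModuleCat.{u} R} (f : Y ⟶ Z) : homOp Z ⟶ homOp Y :=
  NatTrans.rightOp ((linearYoneda R (ModuleCat.{u} R)).map f)

instance preservesLimits_linearYoneda (Y : ModuleCat.{u} R) :
    PreservesLimits ((linearYoneda R (ModuleCat.{u} R)).obj Y) :=
  have : PreservesLimits ((linearYoneda R (ModuleCat.{u} R)).obj Y ⋙ forget _) :=
    (inferInstance : PreservesLimits (yoneda.obj Y))
  preservesLimits_of_reflects_of_preserves _ (forget _)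

instance preservesFiniteColimits_homOp (Y : ModuleCat.{u} R) :
    PreservesFiniteColimits (homOp Y) := by
  have : PreservesFiniteLimits ((linearYoneda R (ModuleCat.{u} R)).obj Y) :=
    inferInstance
  exact preservesFiniteColimits_rightOp _

lemma preservesHomology_homOp (Y : ModuleCat.{u} R) [Injective Y] :
    (homOp Y).PreservesHomology := by
  refine Functor.preservesHomology_of_map_exact _ fun S hS => ?_
  rw [← ShortComplex.exact_unop_iff, ShortComplex.moduleCat_exact_iff]
  intro (φ : S.X₂ ⟶ Y) (h : S.f ≫ φ = 0)
  exact ⟨hS.descToInjective φ h, hS.comp_descToInjective φ h⟩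

section delta

variable {S : ShortComplex (ModuleCat.{u} R)}

lemma homOpMap_zero (X : ModuleCat.{u} R) :
    (homOpMap S.g).app X ≫ (homOpMap S.f).app X = 0 := by
  apply Quiver.Hom.unop_inj
  ext (φ : X ⟶ S.X₁) : 2
  change (φ ≫ S.f) ≫ S.g = 0
  simp

lemma homOpMap_shortExact (hS : S.ShortExact) (X : ModuleCat.{u} R) [Projective X] :
    (ShortComplex.mk _ _ (homOpMap_zero (S := S) X)).ShortExact := by
  have := hS.mono_f
  have := hS.epi_g
  suffices h : (ShortComplex.mk _ _ (homOpMap_zero (S := S) X)).unop.ShortExact from h.op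
  refine ShortComplex.ShortExact.mk' ?_ ?_ ?_
  · rw [ShortComplex.moduleCat_exact_iff]
    intro (φ : X ⟶ S.X₂) (h : φ ≫ S.g = 0)
    exact ⟨hS.exact.lift φ h, hS.exact.lift_f φ h⟩
  · rw [ModuleCat.mono_iff_injective]
    intro (φ : X ⟶ S.X₁) (ψ : X ⟶ S.X₁) (h : φ ≫ S.f = ψ ≫ S.f)
    exact (cancel_mono S.f).1 h
  · rw [ModuleCat.epi_iff_surjective]
    intro (φ : X ⟶ S.X₃)
    exact ⟨Projective.factorThru φ S.g, Projective.factorThru_comp φ S.g⟩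

/-- The functor `t ↦ Ext ^ k (R / I t, Y)`. -/
noncomputable abbrev diagramAt (a : Ideal R) (k : ℕ) (Y : ModuleCat.{u} R) :
    ℕᵒᵖᵒᵖ ⥤ ModuleCat.{u} R :=
  (diagram (idealPowersDiagram a) k).flip.obj Y

noncomputable def diagramAtδ (hS : S.ShortExact) (a : Ideal R) (k : ℕ) :
    diagramAt a k S.X₃ ⟶ diagramAt a (k + 1) S.X₁ :=
  Functor.whiskerLeft (ringModIdeals (idealPowersDiagram a)).op
    (NatTrans.leftOp (Functor.leftDerivedδ (homOpMap S.g) (homOpMap S.f) homOpMap_zero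
      (fun X _ => homOpMap_shortExact hS X) k))

lemma diagramAtδ_app (hS : S.ShortExact) (a : Ideal R) (k : ℕ) (t : ℕᵒᵖᵒᵖ) :
    (diagramAtδ hS a k).app t = ((Functor.leftDerivedδ (homOpMap S.g) (homOpMap S.f) homOpMap_zero
      (fun X _ => homOpMap_shortExact hS X) k).app
        ((ringModIdeals (idealPowersDiagram a)).obj t.unop)).unop :=
  rfl

lemma isIso_diagramAtδ (hS : S.ShortExact) [Injective S.X₂] (a : Ideal R) (k : ℕ) :
    IsIso (diagramAtδ hS a (k + 1)) := by
  have := preservesHomology_homOp S.X₂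
  refine (NatTrans.isIso_iff_isIso_app _).2 fun t => ?_
  rw [diagramAtδ_app]
  have := Functor.isIso_leftDerivedδ_app (homOpMap S.g) (homOpMap S.f) homOpMap_zero
    (fun X _ => homOpMap_shortExact hS X) (k + 1)
    ((ringModIdeals (idealPowersDiagram a)).obj t.unop)
    (Functor.isZero_leftDerived_succ_of_preservesHomology _ _ _)
    (Functor.isZero_leftDerived_succ_of_preservesHomology _ _ _)
  exact (isIso_unop_iff _).2 this

/-- The functor `t ↦ Hom (R / a ^ t, Y)`. -/
noncomputable abbrev homDiagram (a : Ideal R) (Y : ModuleCat.{u} R) : ℕᵒᵖᵒᵖ ⥤ ModuleCat.{u} R :=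
  (ringModIdeals (idealPowersDiagram a)).op ⋙ (linearYoneda R (ModuleCat.{u} R)).obj Y

noncomputable abbrev homDiagramMap (a : Ideal R) {Y Z : ModuleCat.{u} R} (f : Y ⟶ Z) :
    homDiagram a Y ⟶ homDiagram a Z :=
  Functor.whiskerLeft _ ((linearYoneda R (ModuleCat.{u} R)).map f)

/-- `Hom (R / a ^ t, Y)` is `Ext ^ 0 (R / a ^ t, Y)`. -/
noncomputable def homDiagramIso (a : Ideal R) (Y : ModuleCat.{u} R) :
    homDiagram a Y ≅ diagramAt a 0 Y where
  hom := Functor.whiskerLeft (ringModIdeals (idealPowersDiagram a)).op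
    (NatTrans.leftOp (homOp Y).fromLeftDerivedZero)
  inv := Functor.whiskerLeft (ringModIdeals (idealPowersDiagram a)).op
    (NatTrans.leftOp (homOp Y).leftDerivedZeroIsoSelf.inv)
  hom_inv_id := by
    ext t : 2
    exact congr_arg Quiver.Hom.unop ((homOp Y).leftDerivedZeroIsoSelf_inv_hom_id_app
      ((ringModIdeals (idealPowersDiagram a)).obj t.unop))
  inv_hom_id := by
    ext t : 2
    exact congr_arg Quiver.Hom.unop ((homOp Y).leftDerivedZeroIsoSelf_hom_inv_id_app
      ((ringModIdeals (idealPowersDiagram a)).obj t.unop))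

lemma homDiagramIso_naturality (a : Ideal R) {Y Z : ModuleCat.{u} R} (f : Y ⟶ Z) :
    homDiagramMap a f ≫ (homDiagramIso a Z).hom =
      (homDiagramIso a Y).hom ≫ (diagram (idealPowersDiagram a) 0).flip.map f := by
  ext t : 2
  have h := NatTrans.congr_app (Functor.fromLeftDerivedZero_naturality (homOpMap f))
    ((ringModIdeals (idealPowersDiagram a)).obj t.unop)
  exact (congr_arg Quiver.Hom.unop h).symm

lemma exact_diagramAtδ (hS : S.ShortExact) (a : Ideal R) (k : ℕ) (t : ℕᵒᵖᵒᵖ) :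
    Function.Exact (((diagram (idealPowersDiagram a) k).flip.map S.g).app t)
      ((diagramAtδ hS a k).app t) := by
  have := (Functor.exact_leftDerivedδ (homOpMap S.g) (homOpMap S.f) homOpMap_zero
    (fun X _ => homOpMap_shortExact hS X) k
    ((ringModIdeals (idealPowersDiagram a)).obj t.unop)).unop
  exact (ShortComplex.ShortExact.moduleCat_exact_iff_function_exact _).1 this

lemma epi_diagramAtδ (hS : S.ShortExact) [Injective S.X₂] (a : Ideal R) (k : ℕ) (t : ℕᵒᵖᵒᵖ) :
    Function.Surjective ((diagramAtδ hS a k).app t) := by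
  have := preservesHomology_homOp S.X₂
  have := Functor.mono_leftDerivedδ_app (homOpMap S.g) (homOpMap S.f) homOpMap_zero
    (fun X _ => homOpMap_shortExact hS X) k
    ((ringModIdeals (idealPowersDiagram a)).obj t.unop)
    (Functor.isZero_leftDerived_succ_of_preservesHomology _ _ _)
  rw [← ModuleCat.epi_iff_surjective, diagramAtδ_app]
  exact unop_epi_of_mono _

end delta

end localCohomology

namespace localCohomology

open Opposite Limits
variable {R : Type u} [CommRing R]

/-- The elements killed by a power of the ideal `a`. -/
def powTorsion (a : Ideal R) (M : Type*) [AddCommGroup M] [Module R M] : Submodule R M where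
  carrier := {x | ∃ t : ℕ, ∀ r ∈ a ^ t, r • x = 0}
  add_mem' := by
    rintro x y ⟨s, hs⟩ ⟨t, ht⟩
    refine ⟨s + t, fun r hr => ?_⟩
    rw [smul_add, hs r (Ideal.pow_le_pow_right (Nat.le_add_right s t) hr),
      ht r (Ideal.pow_le_pow_right (Nat.le_add_left t s) hr), add_zero]
  zero_mem' := ⟨0, fun r _ => smul_zero r⟩
  smul_mem' := by
    rintro c x ⟨t, ht⟩
    exact ⟨t, fun r hr => by rw [smul_comm, ht r hr, smul_zero]⟩

lemma mem_powTorsion {a : Ideal R} {M : Type*} [AddCommGroup M] [Module R M] {x : M} :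
    x ∈ powTorsion a M ↔ ∃ t : ℕ, ∀ r ∈ a ^ t, r • x = 0 :=
  Iff.rfl

lemma preservesColimitsOfShape_forget :
    PreservesColimitsOfShape ℕᵒᵖᵒᵖ (forget (ModuleCat.{u} R)) := by
  have : PreservesFilteredColimitsOfSize.{0, 0} (forget (ModuleCat.{u} R)) :=
    preservesFilteredColimitsOfSize_shrink _
  infer_instance

lemma exists_rep (F : ℕᵒᵖᵒᵖ ⥤ ModuleCat.{u} R) (x : (colimit F : ModuleCat.{u} R)) :
    ∃ (t : ℕᵒᵖᵒᵖ) (y : F.obj t), colimit.ι F t y = x :=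
  have := preservesColimitsOfShape_forget (R := R)
  Concrete.colimit_exists_rep F x

lemma rep_eq_zero (F : ℕᵒᵖᵒᵖ ⥤ ModuleCat.{u} R) (t : ℕᵒᵖᵒᵖ) (y : F.obj t)
    (hy : colimit.ι F t y = 0) : ∃ (s : ℕᵒᵖᵒᵖ) (i : t ⟶ s), F.map i y = 0 :=
  have := preservesColimitsOfShape_forget (R := R)
  Concrete.colimit_rep_eq_zero R F t y hy

lemma desc_ι_apply (F : ℕᵒᵖᵒᵖ ⥤ ModuleCat.{u} R) (c : Cocone F) (t : ℕᵒᵖᵒᵖ) (y : F.obj t) :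
    colimit.desc F c (colimit.ι F t y) = c.ι.app t y := by
  rw [← ModuleCat.comp_apply, colimit.ι_desc]

lemma colimMap_ι_apply {F G : ℕᵒᵖᵒᵖ ⥤ ModuleCat.{u} R} (φ : F ⟶ G) (t : ℕᵒᵖᵒᵖ) (y : F.obj t) :
    colimMap φ (colimit.ι F t y) = colimit.ι G t (φ.app t y) := by
  rw [← ModuleCat.comp_apply, ι_colimMap, ModuleCat.comp_apply]

/-- Local cohomology as a colimit of modules. -/
noncomputable def objIso (a : Ideal R) (k : ℕ) (Y : ModuleCat.{u} R) :
    (localCohomology a k).obj Y ≅ colimit (diagramAt a k Y) :=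
  colimitObjIsoColimitCompEvaluation (diagram (idealPowersDiagram a) k) Y

noncomputable abbrev quotPow (a : Ideal R) (t : ℕ) : ModuleCat.{u} R :=
  ModuleCat.of R (R ⧸ a ^ t)

/-- The homomorphism from `R / a ^ t` sending `1` to an element killed by `a ^ t`. -/
noncomputable def homOfKilled (a : Ideal R) (t : ℕ) (Y : ModuleCat.{u} R) (y : Y)
    (hy : ∀ r ∈ a ^ t, r • y = 0) : quotPow a t ⟶ Y :=
  ModuleCat.ofHom ((a ^ t).liftQ (LinearMap.toSpanSingleton R Y y) fun r hr => hy r hr)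

lemma homOfKilled_one (a : Ideal R) (t : ℕ) (Y : ModuleCat.{u} R) (y : Y)
    (hy : ∀ r ∈ a ^ t, r • y = 0) : homOfKilled a t Y y hy (Submodule.Quotient.mk 1) = y :=
  one_smul R y

lemma quotPow_hom_ext {a : Ideal R} {t : ℕ} {Y : ModuleCat.{u} R} {f g : quotPow a t ⟶ Y}
    (h : f (Submodule.Quotient.mk 1) = g (Submodule.Quotient.mk 1)) : f = g := by
  refine ModuleCat.hom_ext (LinearMap.ext fun x => ?_)
  obtain ⟨r, rfl⟩ := Submodule.Quotient.mk_surjective _ x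
  have e : (Submodule.Quotient.mk r : R ⧸ a ^ t) = r • Submodule.Quotient.mk 1 := by
    rw [← Submodule.Quotient.mk_smul, smul_eq_mul, mul_one]
  exact (congr_arg f e).trans (((f.hom.map_smul r _).trans
    ((congr_arg (r • ·) h).trans (g.hom.map_smul r _).symm)).trans (congr_arg g e).symm)

lemma smul_apply_one {a : Ideal R} {t : ℕ} {Y : ModuleCat.{u} R} (f : quotPow a t ⟶ Y) (r : R)
    (hr : r ∈ a ^ t) : r • f (Submodule.Quotient.mk 1) = 0 := by
  have e : r • (Submodule.Quotient.mk 1 : R ⧸ a ^ t) = 0 := by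
    rw [← Submodule.Quotient.mk_smul, smul_eq_mul, mul_one]
    exact (Submodule.Quotient.mk_eq_zero _).2 hr
  exact (f.hom.map_smul r _).symm.trans ((congr_arg f e).trans f.hom.map_zero)

/-- Evaluation at `1`, as a cocone over `homDiagram`. -/
noncomputable def homCocone (a : Ideal R) (Y : ModuleCat.{u} R) : Cocone (homDiagram a Y) where
  pt := ModuleCat.of R (powTorsion a Y)
  ι :=
    { app t := ModuleCat.ofHom
        { toFun := fun (f : quotPow a t.unop.unop ⟶ Y) =>
            ⟨f (Submodule.Quotient.mk 1), t.unop.unop, smul_apply_one f⟩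
          map_add' := fun _ _ => rfl
          map_smul' := fun _ _ => rfl }
      naturality _ _ _ := rfl }

lemma bijective_desc_homCocone (a : Ideal R) (Y : ModuleCat.{u} R) :
    Function.Bijective (colimit.desc _ (homCocone a Y)) := by
  constructor
  · rw [injective_iff_map_eq_zero]
    intro x hx
    obtain ⟨t, f, rfl⟩ := exists_rep _ x
    rw [desc_ι_apply] at hx
    have hf : f = 0 := quotPow_hom_ext (congr_arg Subtype.val hx)
    rw [hf, map_zero]
  · rintro ⟨y, t, ht⟩
    refine ⟨colimit.ι (homDiagram a Y) (op (op t)) (homOfKilled a t Y y ht), ?_⟩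
    exact (desc_ι_apply _ _ _ _).trans (Subtype.ext (homOfKilled_one a t Y y ht))

/-- The colimit of `Hom (R / a ^ t, Y)` is the `a`-power torsion of `Y`. -/
noncomputable def homColimitEquiv (a : Ideal R) (Y : ModuleCat.{u} R) :
    (colimit (homDiagram a Y) : ModuleCat.{u} R) ≃ₗ[R] powTorsion a Y :=
  LinearEquiv.ofBijective (colimit.desc _ (homCocone a Y)).hom (bijective_desc_homCocone a Y)

lemma homColimitEquiv_ι (a : Ideal R) (Y : ModuleCat.{u} R) (t : ℕᵒᵖᵒᵖ)
    (f : quotPow a t.unop.unop ⟶ Y) :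
    (homColimitEquiv a Y (colimit.ι (homDiagram a Y) t f) : Y) = f (Submodule.Quotient.mk 1) :=
  congr_arg Subtype.val (desc_ι_apply (homDiagram a Y) (homCocone a Y) t f)

theorem nonempty_zero_equiv (a : Ideal R) (M : Type u) [AddCommGroup M] [Module R M] :
    Nonempty ((localCohomology a 0).obj (ModuleCat.of R M) ≃ₗ[R] powTorsion a M) :=
  ⟨(objIso a 0 (ModuleCat.of R M) ≪≫
    (HasColimit.isoOfNatIso (homDiagramIso a (ModuleCat.of R M))).symm).toLinearEquiv.trans
      (homColimitEquiv a (ModuleCat.of R M))⟩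

section

variable {M I N : Type u} [AddCommGroup M] [Module R M] [AddCommGroup I] [Module R I]
  [AddCommGroup N] [Module R N] {f : M →ₗ[R] I} {g : I →ₗ[R] N} [Module.Injective R I]

theorem nonempty_succ_equiv (a : Ideal R) (k : ℕ) (hf : Function.Injective f)
    (hfg : Function.Exact f g) (hg : Function.Surjective g) :
    Nonempty ((localCohomology a (k + 2)).obj (ModuleCat.of R M) ≃ₗ[R]
      (localCohomology a (k + 1)).obj (ModuleCat.of R N)) := by
  have hI : Injective (ModuleCat.of R I) := Module.injective_object_of_injective_module R I
  let S : ShortComplex (ModuleCat.{u} R) :=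
    ⟨ModuleCat.ofHom f, ModuleCat.ofHom g, ModuleCat.hom_ext hfg.linearMap_comp_eq_zero⟩
  have hS : S.ShortExact := ModuleCat.shortComplex_shortExact S hfg hf hg
  have : Injective S.X₂ := hI
  have := isIso_diagramAtδ hS a k
  exact ⟨(objIso a (k + 2) S.X₁ ≪≫ (HasColimit.isoOfNatIso (asIso (diagramAtδ hS a (k + 1)))).symm
    ≪≫ (objIso a (k + 1) S.X₃).symm).toLinearEquiv⟩

theorem nonempty_one_equiv (a : Ideal R) (hf : Function.Injective f)
    (hfg : Function.Exact f g) (hg : Function.Surjective g) :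
    Nonempty ((localCohomology a 1).obj (ModuleCat.of R M) ≃ₗ[R]
      powTorsion a N ⧸ ((powTorsion a I).map g).submoduleOf (powTorsion a N)) := by
  have hI : Injective (ModuleCat.of R I) := Module.injective_object_of_injective_module R I
  let S : ShortComplex (ModuleCat.{u} R) :=
    ⟨ModuleCat.ofHom f, ModuleCat.ofHom g, ModuleCat.hom_ext hfg.linearMap_comp_eq_zero⟩
  have hS : S.ShortExact := ModuleCat.shortComplex_shortExact S hfg hf hg
  have : Injective S.X₂ := hI
  let ε : homDiagram a S.X₃ ⟶ diagramAt a 1 S.X₁ :=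
    (homDiagramIso a S.X₃).hom ≫ diagramAtδ hS a 0
  have hsurj (t) : Function.Surjective (ε.app t) := by
    rw [← ModuleCat.epi_iff_surjective]
    have := (ModuleCat.epi_iff_surjective _).2 (epi_diagramAtδ hS a 0 t)
    exact epi_comp _ _
  have hexact (t) : Function.Exact ((homDiagramMap a S.g).app t) (ε.app t) := by
    have hn (ψ) : (homDiagramIso a S.X₃).hom.app t ((homDiagramMap a S.g).app t ψ) =
        ((diagram (idealPowersDiagram a) 0).flip.map S.g).app t
          ((homDiagramIso a S.X₂).hom.app t ψ) :=
      congr_arg (fun η => η.app t ψ) (homDiagramIso_naturality a S.g)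
    have hbij (Y : ModuleCat.{u} R) : Function.Bijective ((homDiagramIso a Y).hom.app t) :=
      ConcreteCategory.bijective_of_isIso _
    intro φ
    refine (exact_diagramAtδ hS a 0 t _).trans ⟨?_, ?_⟩
    · rintro ⟨ψ', h⟩
      obtain ⟨ψ, rfl⟩ := (hbij S.X₂).2 ψ'
      exact ⟨ψ, (hbij S.X₃).1 ((hn ψ).trans h)⟩
    · rintro ⟨ψ, rfl⟩
      exact ⟨_, (hn ψ).symm⟩
  let θ : powTorsion a N →ₗ[R] (colimit (diagramAt a 1 S.X₁) : ModuleCat.{u} R) :=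
    (colimMap ε).hom ∘ₗ (homColimitEquiv a S.X₃).symm.toLinearMap
  have hθ : Function.Surjective θ := by
    refine Function.Surjective.comp (g := colimMap ε) ?_ (homColimitEquiv a S.X₃).symm.surjective
    intro x
    obtain ⟨t, y, rfl⟩ := exists_rep _ x
    obtain ⟨z, rfl⟩ := hsurj t y
    exact ⟨_, colimMap_ι_apply ε t z⟩
  have e1 (t φ) : θ (homColimitEquiv a S.X₃ (colimit.ι (homDiagram a S.X₃) t φ)) =
      colimit.ι (diagramAt a 1 S.X₁) t (ε.app t φ) :=
    (congr_arg (colimMap ε) ((homColimitEquiv a S.X₃).symm_apply_apply _)).trans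
      (colimMap_ι_apply ε t φ)
  have hker : LinearMap.ker θ = ((powTorsion a I).map g).submoduleOf (powTorsion a N) := by
    ext x
    obtain ⟨x, rfl⟩ := (homColimitEquiv a S.X₃).surjective x
    obtain ⟨t, φ, rfl⟩ := exists_rep _ x
    have e2 := homColimitEquiv_ι a S.X₃ t φ
    constructor
    · intro hx
      obtain ⟨s, i, hs⟩ := rep_eq_zero _ _ _ ((e1 t φ).symm.trans hx)
      obtain ⟨ψ, hψ⟩ := (hexact s _).1 ((NatTrans.naturality_apply ε i φ).trans hs)
      exact ⟨_, ⟨_, smul_apply_one (Y := ModuleCat.of R I) ψ⟩,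
        (e2.trans (congr_arg (fun η : quotPow a s.unop.unop ⟶ S.X₃ =>
          η (Submodule.Quotient.mk 1)) hψ.symm)).symm⟩
    · rintro ⟨y, ⟨s, hs⟩, hy⟩
      let ψ : (homDiagram a S.X₂).obj (op (op s)) := homOfKilled a s (ModuleCat.of R I) y hs
      have e3 := homColimitEquiv_ι a S.X₃ (op (op s)) ((homDiagramMap a S.g).app _ ψ)
      have e4 : homColimitEquiv a S.X₃ (colimit.ι (homDiagram a S.X₃) t φ) =
          homColimitEquiv a S.X₃ (colimit.ι (homDiagram a S.X₃) (op (op s))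
            ((homDiagramMap a S.g).app _ ψ)) :=
        Subtype.ext (hy.symm.trans ((congr_arg g
          (homOfKilled_one a s (ModuleCat.of R I) y hs)).symm.trans e3.symm))
      rw [LinearMap.mem_ker, e4]
      refine (e1 _ _).trans ((congr_arg _ ((hexact _ _).2 ⟨ψ, rfl⟩)).trans (map_zero _))
  exact ⟨(objIso a 1 S.X₁).toLinearEquiv.trans
    ((θ.quotKerEquivOfSurjective hθ).symm.trans (Submodule.quotEquivOfEq _ _ hker))⟩

end

end localCohomology

namespace localCohomology
variable {R : Type u} [CommRing R]

theorem exists_injective_embedding (M : Type u) [AddCommGroup M] [Module R M] :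
    ∃ (I N : Type u) (_ : AddCommGroup I) (_ : Module R I) (_ : AddCommGroup N) (_ : Module R N)
      (f : M →ₗ[R] I) (g : I →ₗ[R] N), Module.Injective R I ∧ Function.Injective f ∧
        Function.Exact f g ∧ Function.Surjective g := by
  let I := CategoryTheory.Injective.under (ModuleCat.of R M)
  let f : M →ₗ[R] I := (CategoryTheory.Injective.ι (ModuleCat.of R M)).hom
  exact ⟨I, I ⧸ LinearMap.range f, inferInstance, inferInstance, inferInstance, inferInstance,
    f, (LinearMap.range f).mkQ,
    Module.injective_module_of_injective_object R I (inj := inferInstanceAs (Injective I)),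
    (ModuleCat.mono_iff_injective _).1 inferInstance,
    LinearMap.exact_map_mkQ_range f, Submodule.mkQ_surjective _⟩

/-- Local cohomology as a type. -/
abbrev H (a : Ideal R) (k : ℕ) (M : Type u) [AddCommGroup M] [Module R M] : Type u :=
  (localCohomology a k).obj (ModuleCat.of R M)

section torsion

variable {a : Ideal R} {M N : Type*} [AddCommGroup M] [Module R M] [AddCommGroup N] [Module R N]

lemma powTorsion_eq_top_of_surjective (f : M →ₗ[R] N) (hf : Function.Surjective f)
    (h : powTorsion a M = ⊤) : powTorsion a N = ⊤ := by
  rw [eq_top_iff]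
  intro y _
  obtain ⟨x, rfl⟩ := hf y
  obtain ⟨t, ht⟩ : x ∈ powTorsion a M := h ▸ trivial
  exact ⟨t, fun r hr => by rw [← map_smul, ht r hr, map_zero]⟩

lemma powTorsion_powTorsion : powTorsion a (powTorsion a M) = ⊤ := by
  rw [eq_top_iff]
  rintro ⟨x, t, ht⟩ _
  exact ⟨t, fun r hr => Subtype.ext (ht r hr)⟩

lemma map_mem_powTorsion (f : M →ₗ[R] N) {x : M} (hx : x ∈ powTorsion a M) :
    f x ∈ powTorsion a N := by
  obtain ⟨t, ht⟩ := hx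
  exact ⟨t, fun r hr => by rw [← map_smul, ht r hr, map_zero]⟩

/-- The map induced on power torsion. -/
def powTorsionMap (a : Ideal R) (f : M →ₗ[R] N) : powTorsion a M →ₗ[R] powTorsion a N :=
  f.restrict fun _ => map_mem_powTorsion f

lemma submoduleOf_map_powTorsion (f : M →ₗ[R] N) :
    ((powTorsion a M).map f).submoduleOf (powTorsion a N) =
      LinearMap.range (powTorsionMap a f) := by
  ext ⟨x, hx⟩
  constructor
  · rintro ⟨y, hy, h⟩
    exact ⟨⟨y, hy⟩, Subtype.ext h⟩
  · rintro ⟨⟨y, hy⟩, h⟩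
    exact ⟨y, hy, congr_arg Subtype.val h⟩

end torsion

theorem powTorsion_H (a : Ideal R) (k : ℕ) (M : Type u) [AddCommGroup M] [Module R M] :
    powTorsion a (H a k M) = ⊤ := by
  match k with
  | 0 =>
    obtain ⟨e⟩ := nonempty_zero_equiv a M
    exact powTorsion_eq_top_of_surjective e.symm.toLinearMap e.symm.surjective
      powTorsion_powTorsion
  | 1 =>
    obtain ⟨I, N, _, _, _, _, f, g, _, hf, hfg, hg⟩ := exists_injective_embedding (R := R) M
    obtain ⟨e⟩ := nonempty_one_equiv a hf hfg hg
    exact powTorsion_eq_top_of_surjective (e.symm.toLinearMap ∘ₗ Submodule.mkQ _)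
      (e.symm.surjective.comp (Submodule.mkQ_surjective _)) powTorsion_powTorsion
  | k + 2 =>
    obtain ⟨I, N, _, _, _, _, f, g, _, hf, hfg, hg⟩ := exists_injective_embedding (R := R) M
    obtain ⟨e⟩ := nonempty_succ_equiv a k hf hfg hg
    exact powTorsion_eq_top_of_surjective e.symm.toLinearMap e.symm.surjective
      (powTorsion_H a (k + 1) N)

theorem subsingleton_H (a : Ideal R) (k : ℕ) (M : Type u) [AddCommGroup M] [Module R M]
    [Subsingleton M] : Subsingleton (H a k M) := by
  have hI : Module.Injective R M := ⟨fun _ _ _ _ _ _ _ _ _ => ⟨0, fun _ => Subsingleton.elim _ _⟩⟩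
  have hf : Function.Injective (0 : M →ₗ[R] M) := Function.injective_of_subsingleton _
  have hg : Function.Surjective (0 : M →ₗ[R] M) := fun x => ⟨x, Subsingleton.elim _ _⟩
  have hfg : Function.Exact (0 : M →ₗ[R] M) (0 : M →ₗ[R] M) :=
    fun x => ⟨fun _ => ⟨x, Subsingleton.elim _ _⟩, fun _ => Subsingleton.elim _ _⟩
  match k with
  | 0 =>
    obtain ⟨e⟩ := nonempty_zero_equiv a M
    exact e.toEquiv.subsingleton
  | 1 =>
    obtain ⟨e⟩ := nonempty_one_equiv a hf hfg hg
    have := Submodule.mkQ_surjective (((powTorsion a M).map (0 : M →ₗ[R] M)).submoduleOf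
      (powTorsion a M))
    have := this.subsingleton
    exact e.toEquiv.subsingleton
  | k + 2 =>
    obtain ⟨e⟩ := nonempty_succ_equiv a k hf hfg hg
    have := subsingleton_H a (k + 1) M
    exact e.toEquiv.subsingleton

section localization

variable (S : Submonoid R)

lemma isLocalizedModule_powTorsion [IsNoetherianRing R] (A : Type*) [CommRing A] [Algebra R A]
    [IsLocalization S A] (a : Ideal R) {M M' : Type*} [AddCommGroup M] [Module R M]
    [AddCommGroup M'] [Module R M'] [Module A M'] [IsScalarTower R A M'] (f : M →ₗ[R] M')
    [IsLocalizedModule S f] :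
    ∃ φ : powTorsion a M →ₗ[R] powTorsion (a.map (algebraMap R A)) M', IsLocalizedModule S φ ∧
      ∀ x, (φ x : M') = f x := by
  have key (x : M) (s : S) (hx : IsLocalizedModule.mk' f x s ∈
      powTorsion (a.map (algebraMap R A)) M') : ∃ u : S, u • x ∈ powTorsion a M := by
    obtain ⟨t, ht⟩ := hx
    obtain ⟨G, hG⟩ := (isNoetherianRing_iff_ideal_fg R).1 ‹_› (a ^ t)
    have h1 (r : R) (hr : r ∈ G) : ∃ c : S, c • r • x = 0 := by
      have : f (r • x) = f 0 := by
        have h2 := ht (algebraMap R A r) (by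
          rw [← Ideal.map_pow]
          exact Ideal.mem_map_of_mem _ (hG ▸ Ideal.subset_span hr))
        rw [algebraMap_smul, ← IsLocalizedModule.mk'_smul] at h2
        have := (IsLocalizedModule.mk'_eq_zero (f := f) s).1 h2
        rw [this, map_zero]
      obtain ⟨c, hc⟩ := IsLocalizedModule.exists_of_eq (S := S) this
      exact ⟨c, by simpa using hc⟩
    choose! c hc using h1
    refine ⟨∏ r ∈ G, c r, t, fun r hr => ?_⟩
    have h3 : a ^ t ≤ LinearMap.ker (LinearMap.toSpanSingleton R M ((∏ r ∈ G, c r) • x)) := by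
      rw [← hG, Ideal.span_le]
      intro r hr
      obtain ⟨d, hd⟩ := Finset.dvd_prod_of_mem c hr
      rw [SetLike.mem_coe, LinearMap.mem_ker, LinearMap.toSpanSingleton_apply, hd, smul_comm,
        mul_comm, mul_smul, hc r hr, smul_zero]
    exact h3 hr
  have hmap (x : M) (hx : x ∈ powTorsion a M) : f x ∈ powTorsion (a.map (algebraMap R A)) M' := by
    obtain ⟨t, ht⟩ := hx
    refine ⟨t, fun r hr => ?_⟩
    have h3 : (a ^ t).map (algebraMap R A) ≤
        LinearMap.ker (LinearMap.toSpanSingleton A M' (f x)) := by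
      rw [Ideal.map_le_iff_le_comap]
      intro r hr
      rw [Ideal.mem_comap, LinearMap.mem_ker, LinearMap.toSpanSingleton_apply, algebraMap_smul,
        ← map_smul, ht r hr, map_zero]
    rw [← Ideal.map_pow] at hr
    exact h3 hr
  refine ⟨(f ∘ₗ (powTorsion a M).subtype).codRestrict
    ((powTorsion (a.map (algebraMap R A)) M').restrictScalars R) fun x => hmap x x.2, ?_,
    fun x => rfl⟩
  refine ⟨?_, ?_, ?_⟩
  · intro s
    rw [Module.End.isUnit_iff]
    have hu := IsLocalization.map_units A s
    constructor
    · intro x y hxy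
      have h2 : algebraMap R A s • x = algebraMap R A s • y := by
        rw [algebraMap_smul, algebraMap_smul]
        exact hxy
      exact hu.smul_left_cancel.1 h2
    · intro x
      refine ⟨(↑hu.unit⁻¹ : A) • x, ?_⟩
      rw [Module.algebraMap_end_apply, ← algebraMap_smul A, smul_smul, IsUnit.mul_val_inv, one_smul]
  · rintro ⟨y, hy⟩
    obtain ⟨⟨x, s⟩, rfl⟩ := IsLocalizedModule.mk'_surjective S f y
    obtain ⟨c, hc⟩ := key x s hy
    refine ⟨⟨⟨c • x, hc⟩, c * s⟩, Subtype.ext ?_⟩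
    change (c * s) • IsLocalizedModule.mk' f x s = f (c • x)
    rw [mul_smul, IsLocalizedModule.mk'_cancel']
    exact (f.map_smul (c : R) x).symm
  · rintro x y hxy
    obtain ⟨c, hc⟩ := IsLocalizedModule.exists_of_eq (S := S) (f := f) (congr_arg Subtype.val hxy)
    exact ⟨c, Subtype.ext hc⟩

lemma isLocalizedModule_quotient_range (A : Type*) [CommRing A] [Algebra R A]
    [IsLocalization S A] {X Y X' Y' : Type*} [AddCommGroup X] [Module R X] [AddCommGroup Y]
    [Module R Y] [AddCommGroup X'] [Module R X'] [Module A X'] [IsScalarTower R A X']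
    [AddCommGroup Y'] [Module R Y'] [Module A Y'] [IsScalarTower R A Y']
    (φ : X →ₗ[R] X') (ψ : Y →ₗ[R] Y') [IsLocalizedModule S φ] [IsLocalizedModule S ψ]
    (γ : X →ₗ[R] Y) (γ' : X' →ₗ[A] Y') (h : ∀ x, γ' (φ x) = ψ (γ x)) :
    ∃ θ : (Y ⧸ LinearMap.range γ) →ₗ[R] (Y' ⧸ LinearMap.range γ'), IsLocalizedModule S θ := by
  have e : (LinearMap.range γ).localized' A S ψ = LinearMap.range γ' := by
    ext y
    rw [Submodule.mem_localized']
    constructor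
    · rintro ⟨_, ⟨x, rfl⟩, s, rfl⟩
      refine ⟨IsLocalizedModule.mk' φ x s, ?_⟩
      symm
      rw [IsLocalizedModule.mk'_eq_iff, ← h, Submonoid.smul_def, ← algebraMap_smul A (s : R),
        ← map_smul, algebraMap_smul, ← Submonoid.smul_def, IsLocalizedModule.mk'_cancel']
    · rintro ⟨x', rfl⟩
      obtain ⟨⟨x, s⟩, rfl⟩ := IsLocalizedModule.mk'_surjective S φ x'
      refine ⟨_, ⟨x, rfl⟩, s, ?_⟩
      rw [IsLocalizedModule.mk'_eq_iff, ← h, Submonoid.smul_def, ← algebraMap_smul A (s : R),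
        ← map_smul, algebraMap_smul, ← Submonoid.smul_def]
      exact congr_arg γ' (IsLocalizedModule.mk'_cancel' φ x s).symm
  exact e ▸ ⟨(LinearMap.range γ).toLocalizedQuotient' A S ψ, inferInstance⟩

lemma nonempty_localizedModule_equiv {X Y X' Y' : Type*} [AddCommGroup X] [Module R X]
    [AddCommGroup Y] [Module R Y] [AddCommGroup X'] [Module (Localization S) X']
    [AddCommGroup Y'] [Module R Y'] [Module (Localization S) Y']
    [IsScalarTower R (Localization S) Y'] (e : X ≃ₗ[R] Y) (e' : X' ≃ₗ[Localization S] Y')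
    (φ : Y →ₗ[R] Y') [IsLocalizedModule S φ] :
    Nonempty (LocalizedModule S X ≃ₗ[Localization S] X') :=
  ⟨((IsLocalizedModule.iso S (φ ∘ₗ e.toLinearMap)).extendScalarsOfIsLocalization S
    (Localization S)).trans e'.symm⟩

theorem nonempty_localizedModule_H_equiv [IsNoetherianRing R] (a : Ideal R) (k : ℕ) (M : Type u)
    [AddCommGroup M] [Module R M] :
    Nonempty (LocalizedModule S (H a k M) ≃ₗ[Localization S]
      H (a.map (algebraMap R (Localization S))) k (LocalizedModule S M)) := by
  obtain ⟨I, N, _, _, _, _, f, g, _, hf, hfg, hg⟩ := exists_injective_embedding (R := R) M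
  have : Module.Injective (Localization S) (LocalizedModule S I) :=
    Module.injective_of_isLocalizedModule S (LocalizedModule.mkLinearMap S I)
  have hf' : Function.Injective (LocalizedModule.map S f) :=
    LocalizedModule.map_injective S f hf
  have hg' : Function.Surjective (LocalizedModule.map S g) :=
    LocalizedModule.map_surjective S g hg
  have hfg' : Function.Exact (LocalizedModule.map S f) (LocalizedModule.map S g) :=
    LocalizedModule.map_exact S f g hfg
  match k with
  | 0 =>
    obtain ⟨e⟩ := nonempty_zero_equiv a M
    obtain ⟨e'⟩ := nonempty_zero_equiv (a.map (algebraMap R (Localization S)))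
      (LocalizedModule S M)
    obtain ⟨φ, _, _⟩ := isLocalizedModule_powTorsion S (Localization S) a
      (LocalizedModule.mkLinearMap S M)
    exact nonempty_localizedModule_equiv S e e' φ
  | 1 =>
    obtain ⟨e⟩ := nonempty_one_equiv a hf hfg hg
    obtain ⟨e'⟩ := nonempty_one_equiv (a.map (algebraMap R (Localization S))) hf' hfg' hg'
    obtain ⟨φ, _, hφ⟩ := isLocalizedModule_powTorsion S (Localization S) a
      (LocalizedModule.mkLinearMap S I)
    obtain ⟨ψ, _, hψ⟩ := isLocalizedModule_powTorsion S (Localization S) a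
      (LocalizedModule.mkLinearMap S N)
    rw [submoduleOf_map_powTorsion] at e e'
    obtain ⟨θ, _⟩ := isLocalizedModule_quotient_range S (Localization S) φ ψ (powTorsionMap a g)
      (powTorsionMap _ (LocalizedModule.map S g)) fun x => Subtype.ext (by
        rw [hψ]
        refine (congr_arg (LocalizedModule.map S g) (hφ x)).trans ?_
        simp [LocalizedModule.map_mk]
        rfl)
    exact nonempty_localizedModule_equiv S e e' θ
  | k + 2 =>
    obtain ⟨e⟩ := nonempty_succ_equiv a k hf hfg hg
    obtain ⟨e'⟩ := nonempty_succ_equiv (a.map (algebraMap R (Localization S))) k hf' hfg' hg'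
    obtain ⟨e''⟩ := nonempty_localizedModule_H_equiv a (k + 1) N
    exact nonempty_localizedModule_equiv S e (e'.trans e''.symm)
      (LocalizedModule.mkLinearMap S (H a (k + 1) N))

end localization

theorem support_H_subset [IsNoetherianRing R] (a : Ideal R) (k : ℕ) (M : Type u)
    [AddCommGroup M] [Module R M] [Module.Finite R M] :
    Module.support R (H a k M) ⊆ Module.support R (M ⧸ (a • ⊤ : Submodule R M)) := by
  intro p hp
  rw [Module.support_quotient]
  refine ⟨?_, ?_⟩
  · by_contra hM
    rw [Module.notMem_support_iff] at hM
    obtain ⟨e⟩ := nonempty_localizedModule_H_equiv p.asIdeal.primeCompl a k M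
    have := subsingleton_H (a.map (algebraMap R (Localization p.asIdeal.primeCompl))) k
      (LocalizedModule p.asIdeal.primeCompl M)
    exact Module.notMem_support_iff.2 e.toEquiv.subsingleton hp
  · rw [PrimeSpectrum.mem_zeroLocus]
    obtain ⟨x, hx⟩ := Module.mem_support_iff_exists_annihilator.1 hp
    obtain ⟨t, ht⟩ : x ∈ powTorsion a (H a k M) := powTorsion_H a k M ▸ trivial
    refine (Ideal.IsPrime.le_of_pow_le (n := t) fun r hr => hx ?_ : a ≤ p.asIdeal)
    rw [Submodule.mem_annihilator_span_singleton]
    exact ht r hr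

section serre

variable {R : Type*} [CommRing R]

/-- A module is finitely generated up to `W` if it has a finitely generated submodule whose
quotient has no support on the set of primes `W`. -/
def FGOn (W : Set (PrimeSpectrum R)) (X : Type*) [AddCommGroup X] [Module R X] : Prop :=
  ∃ N : Submodule R X, N.FG ∧ ∀ p ∈ W, ∀ x : X, ∃ s ∉ p.asIdeal, s • x ∈ N

namespace FGOn

variable {W : Set (PrimeSpectrum R)} {X Y Z : Type*} [AddCommGroup X] [Module R X]
  [AddCommGroup Y] [Module R Y] [AddCommGroup Z] [Module R Z]

lemma of_finite [Module.Finite R X] : FGOn W X :=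
  ⟨⊤, Module.Finite.fg_top, fun p _ _ => ⟨1, p.asIdeal.ne_top_iff_one.1 p.2.ne_top, trivial⟩⟩

lemma of_surjective (f : X →ₗ[R] Y) (hf : Function.Surjective f) (h : FGOn W X) : FGOn W Y := by
  obtain ⟨N, hN, h⟩ := h
  refine ⟨N.map f, hN.map f, fun p hp y => ?_⟩
  obtain ⟨x, rfl⟩ := hf y
  obtain ⟨s, hs, hx⟩ := h p hp x
  exact ⟨s, hs, by simpa using Submodule.mem_map_of_mem (f := f) hx⟩

lemma of_injective [IsNoetherianRing R] (f : X →ₗ[R] Y) (hf : Function.Injective f)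
    (h : FGOn W Y) : FGOn W X := by
  obtain ⟨N, hN, h⟩ := h
  refine ⟨N.comap f, ?_, fun p hp x => ?_⟩
  · have : Module.Finite R N := Module.Finite.iff_fg.2 hN
    let g : N.comap f →ₗ[R] N := f.restrict fun x hx => hx
    have hg : Function.Injective g := fun x y hxy => Subtype.ext (hf (congrArg Subtype.val hxy))
    exact Module.Finite.iff_fg.1 (Module.Finite.of_injective g hg)
  · obtain ⟨s, hs, hx⟩ := h p hp (f x)
    exact ⟨s, hs, by simpa using hx⟩

lemma of_equiv (e : X ≃ₗ[R] Y) (h : FGOn W X) : FGOn W Y :=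
  h.of_surjective e.toLinearMap e.surjective

lemma of_exact [IsNoetherianRing R] (f : X →ₗ[R] Y) (g : Y →ₗ[R] Z) (hfg : Function.Exact f g)
    (hX : FGOn W X) (hZ : FGOn W Z) : FGOn W Y := by
  obtain ⟨A, hA, hX⟩ := hX
  obtain ⟨C, hC, hZ⟩ := hZ.of_injective (LinearMap.range g).subtype Subtype.val_injective
  obtain ⟨B, hB, hBC⟩ : ∃ B : Submodule R Y, B.FG ∧ B.map g.rangeRestrict = C := by
    obtain ⟨s, rfl⟩ := hC
    classical
    obtain ⟨t, rfl⟩ : ∃ t : Finset Y, t.image g.rangeRestrict = s :=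
      ⟨s.image (Function.surjInv g.surjective_rangeRestrict), by
        rw [Finset.image_image, (Function.rightInverse_surjInv _).comp_eq_id, Finset.image_id]⟩
    exact ⟨Submodule.span R t, ⟨t, rfl⟩, by rw [Submodule.map_span, Finset.coe_image]⟩
  refine ⟨A.map f ⊔ B, (hA.map f).sup hB, fun p hp y => ?_⟩
  obtain ⟨s, hs, hy⟩ := hZ p hp (g.rangeRestrict y)
  rw [← hBC] at hy
  obtain ⟨b, hb, hby⟩ := hy
  have hby : g b = s • g y := congrArg Subtype.val hby
  obtain ⟨x, hx⟩ := (hfg (s • y - b)).1 (by simp [hby])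
  obtain ⟨r, hr, hrx⟩ := hX p hp x
  refine ⟨r * s, fun h => (p.2.mem_or_mem h).elim hr hs, ?_⟩
  have : (r * s) • y = f (r • x) + r • b := by
    rw [map_smul, hx, smul_sub, mul_smul, sub_add_cancel]
  rw [this]
  exact Submodule.add_mem_sup (Submodule.mem_map_of_mem hrx) (B.smul_mem r hb)

lemma pi [IsNoetherianRing R] (h : FGOn W X) (m : ℕ) : FGOn W (Fin m → X) := by
  obtain ⟨N, hN, h⟩ := h
  have : Module.Finite R N := Module.Finite.iff_fg.2 hN
  refine ⟨LinearMap.range (LinearMap.compLeft N.subtype (Fin m)),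
    Module.Finite.iff_fg.1 inferInstance, fun p hp x => ?_⟩
  choose s hs hx using fun i => h p hp (x i)
  refine ⟨∏ i, s i, fun hmem => ?_, fun i => ⟨(∏ i, s i) • x i, ?_⟩, rfl⟩
  · obtain ⟨i, -, hi⟩ := (Ideal.IsPrime.prod_mem_iff (hp := p.2)).1 hmem
    exact hs i hi
  · obtain ⟨c, hc⟩ := Finset.dvd_prod_of_mem s (Finset.mem_univ i)
    rw [hc, mul_comm, mul_smul]
    exact N.smul_mem c (hx i)

lemma of_disjoint_support (h : ∀ p ∈ W, p ∉ Module.support R X) : FGOn W X :=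
  ⟨⊥, Submodule.fg_bot, fun p hp => by simpa using Module.notMem_support_iff'.1 (h p hp)⟩

end FGOn

end serre

section dimension

variable {R : Type u} [CommRing R]

/-- The primes `p` with `dim R/p ≥ n`. -/
def dimGE (R : Type u) [CommRing R] (n : ℕ) : Set (PrimeSpectrum R) :=
  {p | (n : WithBot ℕ∞) ≤ ringKrullDim (R ⧸ p.asIdeal)}

lemma krullDim_support_lt_iff (X : Type*) [AddCommGroup X] [Module R X] (n : ℕ) :
    Order.krullDim (Module.support R X) < (n : WithBot ℕ∞) ↔
      ∀ p ∈ dimGE R n, p ∉ Module.support R X := by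
  rw [← not_le, ← not_iff_not, not_not]
  push Not
  constructor
  · rw [Order.le_krullDim_iff]
    rintro ⟨l, hl⟩
    refine ⟨l.head.1, ?_, l.head.2⟩
    rw [dimGE, Set.mem_ofPred_eq, ringKrullDim_quotient, Order.le_krullDim_iff]
    refine ⟨⟨l.length, fun i => ⟨(l i).1, ?_⟩, fun i => l.step i⟩, hl⟩
    exact (PrimeSpectrum.mem_zeroLocus _ _).2 (l.monotone (Fin.zero_le i) : l.head ≤ l i)
  · rintro ⟨p, hp, hpX⟩
    refine hp.trans ?_
    rw [ringKrullDim_quotient]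
    exact Order.krullDim_le_of_strictMono
      (fun q => (⟨q.1, Module.mem_support_mono ((PrimeSpectrum.mem_zeroLocus _ _).1 q.2) hpX⟩ :
        Module.support R X)) fun _ _ h => h

lemma inDimLT_iff (X : Type u) [AddCommGroup X] [Module R X] (n : ℕ) :
    InDimLT R X n ↔ FGOn (dimGE R n) X := by
  refine exists_congr fun N => and_congr_right fun _ => ?_
  rw [krullDim_support_lt_iff]
  refine forall₂_congr fun p hp => ?_
  rw [Module.notMem_support_iff', N.mkQ_surjective.forall]
  refine forall_congr' fun x => exists_congr fun s => and_congr_right fun _ => ?_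
  rw [← map_smul, Submodule.mkQ_apply, Submodule.Quotient.mk_eq_zero]

end dimension

section injective

variable {R : Type u} [CommRing R]

lemma exists_pow_smul_eq_zero (a : Ideal R) {X : Type*} [AddCommGroup X] [Module R X]
    (P : Submodule R X) (hP : P.FG) (h : P ≤ powTorsion a X) :
    ∃ t : ℕ, ∀ r ∈ a ^ t, ∀ x ∈ P, r • x = 0 := by
  obtain ⟨s, rfl⟩ := hP
  choose t ht using fun x : s => h (Submodule.subset_span x.2)
  refine ⟨s.attach.sup t, fun r hr x hx => ?_⟩
  have : Submodule.span R (s : Set X) ≤ LinearMap.ker (LinearMap.lsmul R X r) :=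
    Submodule.span_le.2 fun y hy => ht ⟨y, hy⟩ r
      (Ideal.pow_le_pow_right (Finset.le_sup (f := t) (Finset.mem_attach s ⟨y, hy⟩)) hr)
  exact this hx

theorem injective_powTorsion [IsNoetherianRing R] (a : Ideal R) (I : Type u) [AddCommGroup I] [Module R I]
    [Module.Injective R I] : Module.Injective R (powTorsion a I) := by
  refine Module.Baer.injective fun J f => ?_
  obtain ⟨t, ht⟩ := exists_pow_smul_eq_zero a
    (LinearMap.range ((powTorsion a I).subtype ∘ₗ f)) (Module.Finite.iff_fg.1 inferInstance)
    (by rintro _ ⟨x, rfl⟩; exact (f x).2)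
  obtain ⟨k, hk⟩ := Ideal.exists_pow_inf_eq_pow_smul a J
  have hk' : a ^ (k + t) ⊓ J ≤ a ^ t • J := by
    have := hk (k + t) (Nat.le_add_right _ _)
    simp only [smul_eq_mul, Ideal.mul_top, Nat.add_sub_cancel_left] at this
    rw [this]
    exact Submodule.smul_mono le_rfl inf_le_right
  let q : J →ₗ[R] R ⧸ a ^ (k + t) := (a ^ (k + t)).mkQ ∘ₗ J.subtype
  let f' : J →ₗ[R] I := (powTorsion a I).subtype ∘ₗ f
  have hq : LinearMap.ker q ≤ LinearMap.ker f' := by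
    intro x hx
    have hx : (x : R) ∈ a ^ (k + t) := by
      exact Ideal.Quotient.eq_zero_iff_mem.1 hx
    have hx : (x : R) ∈ (a ^ t • (⊤ : Submodule R J)).map J.subtype := by
      rw [Submodule.map_smul'', Submodule.map_subtype_top]
      exact hk' ⟨hx, x.2⟩
    have hx : x ∈ a ^ t • (⊤ : Submodule R J) := by
      obtain ⟨y, hy, hyx⟩ := hx
      rwa [← Subtype.ext hyx]
    refine (Submodule.smul_le.2 fun r hr y _ => ?_ : a ^ t • (⊤ : Submodule R J) ≤ _) hx
    rw [LinearMap.mem_ker, map_smul]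
    exact ht r hr _ ⟨y, rfl⟩
  obtain ⟨g, hg⟩ := Module.Injective.out (LinearMap.range q).subtype Subtype.val_injective
    ((LinearMap.ker q).liftQ f' hq ∘ₗ q.quotKerEquivRange.symm.toLinearMap)
  have hgf (x : J) : g ((a ^ (k + t)).mkQ x) = f' x := by
    have := hg ⟨q x, x, rfl⟩
    refine this.trans ?_
    rw [LinearMap.comp_apply, LinearEquiv.coe_coe,
      show (⟨q x, x, rfl⟩ : LinearMap.range q) = q.quotKerEquivRange (Submodule.Quotient.mk x) from
        rfl, LinearEquiv.symm_apply_apply, Submodule.liftQ_apply]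
  refine ⟨((g ∘ₗ (a ^ (k + t)).mkQ).codRestrict (powTorsion a I) fun r => ?_), fun x hx => ?_⟩
  · refine mem_powTorsion.2 ⟨k + t, fun s hs => ?_⟩
    rw [← map_smul]
    have : (a ^ (k + t)).mkQ (s • r) = 0 := by
      exact Ideal.Quotient.eq_zero_iff_mem.2 (Ideal.mul_mem_right r _ hs)
    rw [LinearMap.comp_apply, this, map_zero]
  · exact Subtype.ext (hgf ⟨x, hx⟩)

end injective

section ext

open Abelian

variable {R : Type u} [CommRing R]

/-- The module `Ext^k(K, X)`. -/
abbrev E (K X : Type u) [AddCommGroup K] [Module R K] [AddCommGroup X] [Module R X] (k : ℕ) :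
    Type u :=
  Ext (ModuleCat.of R K) (ModuleCat.of R X) k

variable {K X Y Z : Type u} [AddCommGroup K] [Module R K] [AddCommGroup X] [Module R X]
  [AddCommGroup Y] [Module R Y] [AddCommGroup Z] [Module R Z]

/-- The map `Ext^k(K, X) → Ext^k(K, Y)` induced by a linear map `X → Y`. -/
noncomputable def E.map (K : Type u) [AddCommGroup K] [Module R K] (k : ℕ) (f : X →ₗ[R] Y) :
    E (R := R) K X k →ₗ[R] E (R := R) K Y k :=
  (Ext.mk₀ (ModuleCat.ofHom f)).postcompOfLinear R (ModuleCat.of R K) (add_zero k)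

/-- `Ext^0(K, X)` is `Hom(K, X)`. -/
noncomputable def E.zeroEquiv : E (R := R) K X 0 ≃ₗ[R] (K →ₗ[R] X) :=
  Ext.linearEquiv₀.trans ModuleCat.homLinearEquiv

lemma E.zeroEquiv_symm (x : ModuleCat.of R K ⟶ ModuleCat.of R X) :
    E.zeroEquiv ((Ext.linearEquiv₀ (R := R)).symm x) = x.hom :=
  congrArg ModuleCat.Hom.hom ((Ext.linearEquiv₀ (R := R)).apply_symm_apply x)

lemma E.zeroEquiv_map (f : X →ₗ[R] Y) (x : E (R := R) K X 0) :
    E.zeroEquiv (E.map K 0 f x) = f ∘ₗ E.zeroEquiv x := by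
  obtain ⟨x, rfl⟩ := Ext.linearEquiv₀ (R := R).symm.surjective x
  have h : E.map K 0 f ((Ext.linearEquiv₀ (R := R)).symm x) =
      (Ext.linearEquiv₀ (R := R)).symm (x ≫ ModuleCat.ofHom f) :=
    Ext.mk₀_comp_mk₀ _ _
  rw [h, E.zeroEquiv_symm, E.zeroEquiv_symm, ModuleCat.hom_comp, ModuleCat.hom_ofHom]

variable {f : X →ₗ[R] Y} {g : Y →ₗ[R] Z}

lemma E.exact_map (hf : Function.Injective f) (hfg : Function.Exact f g)
    (hg : Function.Surjective g) (k : ℕ) :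
    Function.Exact (E.map K k f) (E.map K k g) := by
  let S : ShortComplex (ModuleCat.{u} R) :=
    ⟨ModuleCat.ofHom f, ModuleCat.ofHom g, ModuleCat.hom_ext hfg.linearMap_comp_eq_zero⟩
  have hS : S.ShortExact := ModuleCat.shortComplex_shortExact S hfg hf hg
  exact (ShortComplex.ab_exact_iff_function_exact _).1
    (Ext.covariant_sequence_exact₂' (ModuleCat.of R K) hS k)

lemma E.exists_connecting (K : Type u) [AddCommGroup K] [Module R K] (hf : Function.Injective f)
    (hfg : Function.Exact f g) (hg : Function.Surjective g) (k : ℕ) :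
    ∃ δ : E (R := R) K Z k →ₗ[R] E (R := R) K X (k + 1),
      Function.Exact (E.map K k g) δ ∧ Function.Exact δ (E.map K (k + 1) f) := by
  let S : ShortComplex (ModuleCat.{u} R) :=
    ⟨ModuleCat.ofHom f, ModuleCat.ofHom g, ModuleCat.hom_ext hfg.linearMap_comp_eq_zero⟩
  have hS : S.ShortExact := ModuleCat.shortComplex_shortExact S hfg hf hg
  exact ⟨hS.extClass.postcompOfLinear R (ModuleCat.of R K) rfl,
    (ShortComplex.ab_exact_iff_function_exact _).1
      (Ext.covariant_sequence_exact₃' (ModuleCat.of R K) hS k (k + 1) rfl),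
    (ShortComplex.ab_exact_iff_function_exact _).1
      (Ext.covariant_sequence_exact₁' (ModuleCat.of R K) hS k (k + 1) rfl)⟩

lemma E.exists_connecting_zero (K : Type u) [AddCommGroup K] [Module R K]
    (hf : Function.Injective f) (hfg : Function.Exact f g) (hg : Function.Surjective g) :
    ∃ δ : (K →ₗ[R] Z) →ₗ[R] E (R := R) K X 1, ∀ φ, δ φ = 0 ↔ ∃ ψ : K →ₗ[R] Y, g ∘ₗ ψ = φ := by
  obtain ⟨δ, hδ, -⟩ := E.exists_connecting K hf hfg hg 0
  refine ⟨δ ∘ₗ E.zeroEquiv.symm.toLinearMap, fun φ => (hδ _).trans ⟨?_, ?_⟩⟩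
  · rintro ⟨ψ, h⟩
    exact ⟨E.zeroEquiv ψ, by rw [← E.zeroEquiv_map, h]; exact E.zeroEquiv.apply_symm_apply φ⟩
  · rintro ⟨ψ, rfl⟩
    refine ⟨E.zeroEquiv.symm ψ, E.zeroEquiv.injective ?_⟩
    rw [E.zeroEquiv_map, LinearEquiv.apply_symm_apply]
    exact (E.zeroEquiv.apply_symm_apply _).symm

lemma E.subsingleton_succ [Module.Injective R Y] (k : ℕ) :
    Subsingleton (E (R := R) K Y (k + 1)) := by
  have : Injective (ModuleCat.of R Y) := Module.injective_object_of_injective_module R Y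
  exact Ext.subsingleton_of_injective _ _ k

lemma E.exists_injective_connecting [Module.Injective R Y] (K : Type u) [AddCommGroup K]
    [Module R K] (hf : Function.Injective f) (hfg : Function.Exact f g)
    (hg : Function.Surjective g) (k : ℕ) :
    ∃ δ : E (R := R) K Z (k + 1) →ₗ[R] E (R := R) K X (k + 2), Function.Injective δ := by
  obtain ⟨δ, hδ, -⟩ := E.exists_connecting K hf hfg hg (k + 1)
  refine ⟨δ, (injective_iff_map_eq_zero δ).2 fun z hz => ?_⟩
  obtain ⟨y, rfl⟩ := (hδ z).1 hz
  have := E.subsingleton_succ (R := R) (K := K) (Y := Y) k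
  rw [Subsingleton.elim y 0, map_zero]

theorem FGOn.ext [IsNoetherianRing R] {W : Set (PrimeSpectrum R)} (h : FGOn W X) (K : Type u)
    [AddCommGroup K] [Module R K] [Module.Finite R K] (k : ℕ) :
    FGOn W (E (R := R) K X k) := by
  induction k generalizing K with
  | zero =>
    obtain ⟨m, p, hp⟩ := Module.Finite.exists_fin' R K
    let F : (K →ₗ[R] X) →ₗ[R] (Fin m → X) :=
      { toFun φ i := φ (p (Pi.single i 1))
        map_add' _ _ := rfl
        map_smul' _ _ := rfl }
    have hF : Function.Injective F := by
      intro φ ψ hφ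
      refine (LinearMap.cancel_right hp).1 (LinearMap.pi_ext' fun i => LinearMap.ext_ring ?_)
      exact congrFun hφ i
    exact ((h.pi m).of_injective F hF).of_equiv E.zeroEquiv.symm
  | succ n ih =>
    obtain ⟨N, _, _, _, _, f, surjf⟩ := Module.exists_finite_presentation R K
    let exac := LinearMap.shortExact_shortComplexKer surjf
    exact (ih (LinearMap.ker f)).of_surjective
      (exac.extClass.precompOfLinear R (ModuleCat.of R X) (add_comm 1 n))
      (precomp_extClass_surjective_of_projective_X₂ (ModuleCat.of R X) exac n)

end ext

section socle

variable {R : Type u} [CommRing R] {W : Set (PrimeSpectrum R)}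

lemma FGOn.range_of_ker_le {A C D : Type*} [AddCommGroup A] [Module R A] [AddCommGroup C]
    [Module R C] [AddCommGroup D] [Module R D] [IsNoetherianRing R] (φ : A →ₗ[R] C)
    (ψ : A →ₗ[R] D) (h : LinearMap.ker φ ≤ LinearMap.ker ψ) (hC : FGOn W C) :
    FGOn W (LinearMap.range ψ) := by
  have h1 : FGOn W (A ⧸ LinearMap.ker φ) :=
    hC.of_injective ((LinearMap.ker φ).liftQ φ le_rfl)
      (LinearMap.ker_eq_bot.1 (Submodule.ker_liftQ_eq_bot _ _ _ le_rfl))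
  refine h1.of_surjective ((LinearMap.ker φ).liftQ ψ.rangeRestrict ?_) fun y => ?_
  · rwa [LinearMap.ker_rangeRestrict]
  · obtain ⟨x, rfl⟩ := ψ.surjective_rangeRestrict y
    exact ⟨Submodule.Quotient.mk x, rfl⟩

variable {a : Ideal R} {M I N : Type u} [AddCommGroup M] [Module R M] [AddCommGroup I] [Module R I]
  [AddCommGroup N] [Module R N] {f : M →ₗ[R] I} {g : I →ₗ[R] N}

lemma injective_powTorsionMap (hf : Function.Injective f) :
    Function.Injective (powTorsionMap a f) :=
  fun _ _ h => Subtype.ext (hf (congrArg Subtype.val h))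

lemma exact_powTorsionMap (hf : Function.Injective f) (hfg : Function.Exact f g) :
    Function.Exact (powTorsionMap a f) (powTorsionMap a g).rangeRestrict := by
  intro y
  have h1 : (powTorsionMap a g).rangeRestrict y = 0 ↔ g y = 0 := by
    rw [Subtype.ext_iff, Subtype.ext_iff]; rfl
  rw [h1]
  refine (hfg _).trans ⟨?_, ?_⟩
  · rintro ⟨x, hx⟩
    obtain ⟨t, ht⟩ := y.2
    exact ⟨⟨x, t, fun r hr => hf (by rw [map_smul, hx, ht r hr, map_zero])⟩, Subtype.ext hx⟩
  · rintro ⟨x, rfl⟩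
    exact ⟨x, rfl⟩

variable [IsNoetherianRing R] [Module.Injective R I]
  (K : Type u) [AddCommGroup K] [Module R K]

lemma fgOn_ext_range_powTorsionMap (hf : Function.Injective f) (hfg : Function.Exact f g) (k : ℕ)
    (h : FGOn W (E (R := R) K (powTorsion a M) (k + 2))) :
    FGOn W (E (R := R) K (LinearMap.range (powTorsionMap a g)) (k + 1)) := by
  have := injective_powTorsion a I
  obtain ⟨δ, hδ⟩ := E.exists_injective_connecting K (injective_powTorsionMap (a := a) hf)
    (exact_powTorsionMap hf hfg) (powTorsionMap a g).surjective_rangeRestrict k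
  exact h.of_injective δ hδ

lemma fgOn_hom_H_one (hf : Function.Injective f) (hfg : Function.Exact f g)
    (hg : Function.Surjective g) (hK : powTorsion a K = ⊤)
    (h₂ : FGOn W (E (R := R) K (powTorsion a M) 2)) (h₁ : FGOn W (E (R := R) K M 1)) :
    FGOn W (K →ₗ[R] H a 1 M) := by
  obtain ⟨e⟩ := nonempty_one_equiv a hf hfg hg
  rw [submoduleOf_map_powTorsion] at e
  refine FGOn.of_equiv (LinearEquiv.congrRight e.symm) ?_
  set B := LinearMap.range (powTorsionMap a g)
  obtain ⟨δ, hδ⟩ := E.exists_connecting_zero K B.subtype_injective (LinearMap.exact_subtype_mkQ B)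
    B.mkQ_surjective
  obtain ⟨ε, hε⟩ := E.exists_connecting_zero K hf hfg hg
  let c : (K →ₗ[R] powTorsion a N) →ₗ[R] (K →ₗ[R] powTorsion a N ⧸ B) :=
    LinearMap.compRight R B.mkQ
  have hc : Function.Exact (LinearMap.range c).subtype δ := fun φ =>
    (hδ φ).trans ⟨fun ⟨ψ, h⟩ => ⟨⟨φ, ψ, h⟩, rfl⟩, fun ⟨⟨_, ψ, h⟩, h'⟩ => ⟨ψ, h.trans h'⟩⟩
  refine FGOn.of_exact (X := LinearMap.range c) (LinearMap.range c).subtype δ hc ?_ (fgOn_ext_range_powTorsionMap K hf hfg 0 h₂)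
  refine FGOn.range_of_ker_le (ε ∘ₗ LinearMap.compRight R (powTorsion a N).subtype) _
    (fun φ hφ => ?_) h₁
  obtain ⟨ψ, hψ⟩ := (hε _).1 hφ
  refine LinearMap.ext fun x => (Submodule.Quotient.mk_eq_zero _).2 ?_
  exact ⟨⟨ψ x, map_mem_powTorsion ψ (hK ▸ trivial)⟩, Subtype.ext (LinearMap.congr_fun hψ x)⟩

theorem fgOn_hom_H_succ [Module.Finite R K] (hK : powTorsion a K = ⊤) (i : ℕ) (M : Type u)
    [AddCommGroup M] [Module R M] (h₂ : FGOn W (E (R := R) K (powTorsion a M) (i + 2)))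
    (h₁ : FGOn W (E (R := R) K M (i + 1))) (h : ∀ j < i, FGOn W (H a (j + 1) M)) :
    FGOn W (K →ₗ[R] H a (i + 1) M) := by
  induction i generalizing M with
  | zero =>
    obtain ⟨I, N, _, _, _, _, f, g, _, hf, hfg, hg⟩ := exists_injective_embedding (R := R) M
    exact fgOn_hom_H_one K hf hfg hg hK h₂ h₁
  | succ i ih =>
    obtain ⟨I, N, _, _, _, _, f, g, _, hf, hfg, hg⟩ := exists_injective_embedding (R := R) M
    have e (j : ℕ) := nonempty_succ_equiv a j hf hfg hg
    refine FGOn.of_equiv (LinearEquiv.congrRight (e i).some.symm) (ih N ?_ ?_ fun j hj => ?_)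
    · set B := LinearMap.range (powTorsionMap a g)
      have hQ : FGOn W (powTorsion a N ⧸ B) := by
        obtain ⟨e⟩ := nonempty_one_equiv a hf hfg hg
        rw [submoduleOf_map_powTorsion] at e
        exact (h 0 i.succ_pos).of_equiv e
      exact FGOn.of_exact _ _ (E.exact_map B.subtype_injective (LinearMap.exact_subtype_mkQ B)
        B.mkQ_surjective (i + 2)) (fgOn_ext_range_powTorsionMap K hf hfg (i + 1) h₂)
        (hQ.ext K (i + 2))
    · obtain ⟨δ, hδ⟩ := E.exists_injective_connecting K hf hfg hg i
      exact h₁.of_injective δ hδ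
    · exact (h (j + 1) (Nat.succ_lt_succ hj)).of_equiv (e j).some

theorem fgOn_hom_H [Module.Finite R M] [Module.Finite R K] (hK : powTorsion a K = ⊤) (i : ℕ)
    (h : ∀ j < i, FGOn W (H a j M)) : FGOn W (K →ₗ[R] H a i M) := by
  cases i with
  | zero =>
    have : Module.Finite R (H a 0 M) := Module.Finite.equiv (nonempty_zero_equiv a M).some.symm
    exact FGOn.of_finite
  | succ i =>
    exact fgOn_hom_H_succ K hK i M (FGOn.of_finite.ext K _) (FGOn.of_finite.ext K _)
      fun j hj => h (j + 1) (Nat.succ_lt_succ hj)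

theorem fgOn_torsionBySet_H [Module.Finite R M] (t i : ℕ)
    (h : ∀ j < i, FGOn W (H a j M)) :
    FGOn W (Submodule.torsionBySet R (H a i M) (a ^ t : Ideal R)) := by
  have hK : powTorsion a (R ⧸ a ^ t) = ⊤ := by
    refine eq_top_iff.2 fun x _ => ⟨t, fun r hr => ?_⟩
    obtain ⟨x, rfl⟩ := Ideal.Quotient.mk_surjective x
    exact Ideal.Quotient.eq_zero_iff_mem.2 (Ideal.mul_mem_right x _ hr)
  have h1 := fgOn_hom_H (R ⧸ a ^ t) hK i h
  let F : (R ⧸ a ^ t →ₗ[R] H a i M) →ₗ[R] H a i M := LinearMap.applyₗ (Ideal.Quotient.mk _ 1)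
  have hF : LinearMap.range F = Submodule.torsionBySet R (H a i M) (a ^ t : Ideal R) := by
    ext x
    rw [Submodule.mem_torsionBySet_iff]
    constructor
    · rintro ⟨φ, rfl⟩ ⟨r, hr⟩
      change r • φ _ = 0
      rw [← map_smul, show r • (Ideal.Quotient.mk (a ^ t) 1) = 0 from
        Ideal.Quotient.eq_zero_iff_mem.2 (Ideal.mul_mem_right 1 _ hr), map_zero]
    · intro hx
      refine ⟨(a ^ t).liftQ (LinearMap.toSpanSingleton R _ x) fun r hr => hx ⟨r, hr⟩, ?_⟩
      exact one_smul R x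
  exact hF ▸ h1.of_surjective F.rangeRestrict F.surjective_rangeRestrict

end socle

section criterion

variable {R : Type u} [CommRing R] [IsNoetherianRing R] {W : Set (PrimeSpectrum R)}

lemma notMem_support_of_forall_associatedPrimes (hW : ∀ p ∈ W, ∀ q ≤ p, q ∈ W) {Y : Type*}
    [AddCommGroup Y] [Module R Y] (h : ∀ p ∈ W, p.asIdeal ∉ associatedPrimes R Y) :
    ∀ p ∈ W, p ∉ Module.support R Y := by
  intro q hq hqY
  obtain ⟨y, hy⟩ := Module.mem_support_iff_exists_annihilator.1 hqY
  obtain ⟨p, hp, hpq⟩ := Ideal.exists_minimalPrimes_le (J := q.asIdeal) hy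
  have hpY : p ∈ associatedPrimes R Y :=
    associatedPrimes.subset_of_injective (Submodule.span R {y}).subtype_injective
      (Module.associatedPrimes.minimalPrimes_annihilator_subset_associatedPrimes R _ hp)
  exact h ⟨p, hp.1.1⟩ (hW q hq _ hpq) hpY

lemma FGOn.finite_setOf_associatedPrimes {X : Type*} [AddCommGroup X] [Module R X]
    (h : FGOn W X) : {p ∈ W | p.asIdeal ∈ associatedPrimes R X}.Finite := by
  obtain ⟨N, hN, h⟩ := h
  have : Module.Finite R N := Module.Finite.iff_fg.2 hN
  refine ((associatedPrimes.finite R N).preimage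
    (fun _ _ _ _ h => PrimeSpectrum.ext h : Set.InjOn PrimeSpectrum.asIdeal _)).subset ?_
  rintro p ⟨hp, hpX⟩
  obtain ⟨-, x, hx⟩ := (isAssociatedPrime_iff (M := X)).1 hpX
  obtain ⟨s, hs, hsx⟩ := h p hp x
  refine (isAssociatedPrime_iff (M := N)).2 ⟨p.2, ⟨s • x, hsx⟩, ?_⟩
  have hx (r : R) : r ∈ p.asIdeal ↔ r • x = 0 := by
    rw [hx, Submodule.mem_colon_singleton, Submodule.mem_bot]
  ext r
  rw [Submodule.mem_colon_singleton, Submodule.mem_bot, Subtype.ext_iff]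
  change _ ↔ r • s • x = 0
  rw [← mul_smul, ← hx]
  exact ⟨fun h => Ideal.mul_mem_right s _ h, fun h => (p.2.mem_or_mem h).resolve_right hs⟩

theorem fgOn_of_torsionBySet (hW : ∀ p ∈ W, ∀ q ≤ p, q ∈ W) (a : Ideal R) {X : Type*}
    [AddCommGroup X] [Module R X] (htors : powTorsion a X = ⊤)
    (hsoc : ∀ t : ℕ, FGOn W (Submodule.torsionBySet R X (a ^ t : Ideal R)))
    (hloc : ∀ p ∈ W, ∃ t : ℕ, ∀ r ∈ a ^ t, ∀ x : X, ∃ s ∉ p.asIdeal, s • r • x = 0) :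
    FGOn W X := by
  have hfin : {p ∈ W | p.asIdeal ∈ associatedPrimes R X}.Finite := by
    refine (hsoc 1).finite_setOf_associatedPrimes.subset ?_
    rintro p ⟨hp, hpX⟩
    refine ⟨hp, ?_⟩
    obtain ⟨-, x, hx⟩ := (isAssociatedPrime_iff (M := X)).1 hpX
    have hx' (r : R) : r ∈ p.asIdeal ↔ r • x = 0 := by
      rw [hx, Submodule.mem_colon_singleton, Submodule.mem_bot]
    obtain ⟨t, ht⟩ : x ∈ powTorsion a X := htors ▸ trivial
    have hap : a ≤ p.asIdeal := p.2.le_of_pow_le fun r hr => (hx' r).2 (ht r hr)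
    refine (isAssociatedPrime_iff (M := Submodule.torsionBySet R X (a ^ 1 : Ideal R))).2
      ⟨p.2, ⟨x, (Submodule.mem_torsionBySet_iff _ _).2 fun r =>
        (hx' r).1 (hap (Ideal.pow_le_self one_ne_zero r.2))⟩, ?_⟩
    ext r
    rw [Submodule.mem_colon_singleton, Submodule.mem_bot, Subtype.ext_iff]
    exact hx' r
  obtain ⟨t, ht⟩ : ∃ t : ℕ, ∀ p ∈ W, p.asIdeal ∈ associatedPrimes R X →
      ∀ r ∈ a ^ t, ∀ x : X, ∃ s ∉ p.asIdeal, s • r • x = 0 := by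
    choose! t ht using hloc
    refine ⟨hfin.toFinset.sup t, fun p hp hpX r hr => ht p hp r (Ideal.pow_le_pow_right ?_ hr)⟩
    exact Finset.le_sup (f := t) (hfin.mem_toFinset.2 ⟨hp, hpX⟩)
  let Y : Submodule R X := a ^ t • ⊤
  have hY : FGOn W Y := by
    refine FGOn.of_disjoint_support (notMem_support_of_forall_associatedPrimes hW ?_)
    intro p hp hpY
    have hpX := associatedPrimes.subset_of_injective Y.subtype_injective hpY
    have hloc (y : X) (hy : y ∈ Y) : ∃ s ∉ p.asIdeal, s • y = 0 := by
      induction hy using Submodule.smul_induction_on' with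
      | smul r hr x _ => exact ht p hp hpX r hr x
      | add x _ y _ hx hy =>
        obtain ⟨s, hs, hx⟩ := hx
        obtain ⟨s', hs', hy⟩ := hy
        refine ⟨s * s', fun h => (p.2.mem_or_mem h).elim hs hs', ?_⟩
        rw [smul_add, mul_comm, mul_smul, hx, mul_comm, mul_smul, hy, smul_zero, smul_zero,
          add_zero]
    obtain ⟨-, y, hy⟩ := (isAssociatedPrime_iff (M := Y)).1 hpY
    obtain ⟨s, hs, hsy⟩ := hloc y y.2
    refine hs ?_
    rw [hy, Submodule.mem_colon_singleton, Submodule.mem_bot]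
    exact Subtype.ext hsy
  obtain ⟨m, r, hr⟩ := Submodule.fg_iff_exists_fin_generating_family.1
    (IsNoetherian.noetherian (a ^ t))
  have hr' (i : Fin m) : r i ∈ a ^ t := hr ▸ Submodule.subset_span ⟨i, rfl⟩
  let F : X →ₗ[R] (Fin m → Y) := LinearMap.pi fun i =>
    (LinearMap.lsmul R X (r i)).codRestrict Y fun x => Submodule.smul_mem_smul (hr' i) trivial
  have hF : LinearMap.ker F = Submodule.torsionBySet R X (a ^ t : Ideal R) := by
    ext x
    rw [Submodule.mem_torsionBySet_iff]
    constructor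
    · intro hx s
      have : a ^ t ≤ LinearMap.ker (LinearMap.toSpanSingleton R X x) := by
        rw [← hr, Submodule.span_le]
        rintro _ ⟨i, rfl⟩
        exact congrArg Subtype.val (congrFun hx i)
      exact this s.2
    · exact fun hx => funext fun i => Subtype.ext (hx ⟨r i, hr' i⟩)
  exact FGOn.of_exact (LinearMap.ker F).subtype F (LinearMap.exact_subtype_ker_map F)
    (hF ▸ hsoc t) (hY.pi m)

end criterion

section localization

variable {R : Type u} [CommRing R]

lemma FGOn.finite_localizedModule {W : Set (PrimeSpectrum R)} {X : Type*} [AddCommGroup X]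
    [Module R X] (h : FGOn W X) {p : PrimeSpectrum R} (hp : p ∈ W) :
    Module.Finite (Localization.AtPrime p.asIdeal)
      (LocalizedModule p.asIdeal.primeCompl X) := by
  obtain ⟨N, hN, h⟩ := h
  have : Module.Finite R N := Module.Finite.iff_fg.2 hN
  refine Module.Finite.of_surjective (LocalizedModule.map p.asIdeal.primeCompl N.subtype) ?_
  intro x
  induction x using LocalizedModule.induction_on with
  | h x s =>
    obtain ⟨u, hu, hx⟩ := h p hp x
    refine ⟨LocalizedModule.mk ⟨u • x, hx⟩ (⟨u, hu⟩ * s), ?_⟩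
    rw [LocalizedModule.map_mk]
    exact LocalizedModule.mk_cancel_common_left ⟨u, hu⟩ s x

lemma exists_pow_smul_eq_zero_of_finite_localizedModule (a : Ideal R) {X : Type*}
    [AddCommGroup X] [Module R X] (htors : powTorsion a X = ⊤) (p : PrimeSpectrum R)
    [Module.Finite (Localization.AtPrime p.asIdeal)
      (LocalizedModule p.asIdeal.primeCompl X)] :
    ∃ t : ℕ, ∀ r ∈ a ^ t, ∀ x : X, ∃ s ∉ p.asIdeal, s • r • x = 0 := by
  set S := p.asIdeal.primeCompl
  let A := Localization.AtPrime p.asIdeal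
  have hA : ⊤ ≤ powTorsion (a.map (algebraMap R A)) (LocalizedModule S X) := by
    rintro x -
    induction x using LocalizedModule.induction_on with
    | h x s =>
      obtain ⟨t, ht⟩ : x ∈ powTorsion a X := htors ▸ trivial
      refine ⟨t, fun r hr => ?_⟩
      rw [← Ideal.map_pow] at hr
      refine (Ideal.map_le_iff_le_comap.2 fun r hr => ?_ :
        (a ^ t).map (algebraMap R A) ≤ LinearMap.ker
          (LinearMap.toSpanSingleton A _ (LocalizedModule.mk x s))) hr
      change algebraMap R A r • LocalizedModule.mk x s = 0
      rw [algebraMap_smul, LocalizedModule.smul'_mk, ht r hr, LocalizedModule.zero_mk]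
  obtain ⟨t, ht⟩ := exists_pow_smul_eq_zero _ _ Module.Finite.fg_top hA
  refine ⟨t, fun r hr x => ?_⟩
  have := ht (algebraMap R A r) (Ideal.map_pow (algebraMap R A) a t ▸ Ideal.mem_map_of_mem _ hr)
    (LocalizedModule.mk x 1) trivial
  rw [algebraMap_smul, LocalizedModule.smul'_mk] at this
  obtain ⟨s, hs⟩ := (IsLocalizedModule.eq_zero_iff S (LocalizedModule.mkLinearMap S X)).1 this
  exact ⟨s, s.2, hs⟩

end localization

section main

variable {R M : Type u} [CommRing R] [IsNoetherianRing R] [AddCommGroup M] [Module R M]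

lemma mem_dimGE_of_le {R : Type u} [CommRing R] {n : ℕ} : ∀ p ∈ dimGE R n, ∀ q ≤ p, q ∈ dimGE R n :=
  fun _ hp _ hqp => hp.trans <| ringKrullDim_le_of_surjective
    (Ideal.Quotient.factor hqp) (Ideal.Quotient.factor_surjective hqp)

lemma finite_H_localizedModule_iff (a : Ideal R) (j : ℕ) (p : PrimeSpectrum R) :
    Module.Finite (Localization.AtPrime p.asIdeal)
        (H (a.map (algebraMap R (Localization.AtPrime p.asIdeal))) j
          (LocalizedModule p.asIdeal.primeCompl M)) ↔
      Module.Finite (Localization.AtPrime p.asIdeal)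
        (LocalizedModule p.asIdeal.primeCompl (H a j M)) := by
  obtain ⟨e⟩ := nonempty_localizedModule_H_equiv p.asIdeal.primeCompl a j M
  exact ⟨fun _ => Module.Finite.equiv e.symm, fun _ => Module.Finite.equiv e⟩

theorem hDim_le_fDimN (a : Ideal R) (n : ℕ) : hDim R a M n ≤ fDimN R a M n := by
  refine le_sInf ?_
  rintro _ ⟨p, -, hp, rfl⟩
  refine le_sInf ?_
  rintro _ ⟨j, rfl, hj⟩
  refine sInf_le ⟨j, rfl, fun h => hj ?_⟩
  exact (finite_H_localizedModule_iff a j p).2 (((inDimLT_iff _ n).1 h).finite_localizedModule hp)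

theorem fgOn_H_of_lt_fDimN [Module.Finite R M] (a : Ideal R) (n j : ℕ) (hj : (j : ℕ∞) < fDimN R a M n) :
    FGOn (dimGE R n) (H a j M) := by
  induction j using Nat.strong_induction_on with
  | h j ih =>
    refine fgOn_of_torsionBySet mem_dimGE_of_le a (powTorsion_H a j M)
      (fun t => fgOn_torsionBySet_H t j fun k hk => ih k hk ((Nat.cast_lt.2 hk).trans hj))
      fun p hp => ?_
    have : Module.Finite (Localization.AtPrime p.asIdeal)
        (LocalizedModule p.asIdeal.primeCompl (H a j M)) := by
      by_cases hpM : p ∈ Module.support R (M ⧸ (a • ⊤ : Submodule R M))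
      · rw [← finite_H_localizedModule_iff]
        by_contra hfin
        have h₁ : fDimN R a M n ≤ _ := sInf_le ⟨p, hpM, hp, rfl⟩
        have h₂ : fDim (Localization.AtPrime p.asIdeal) _ _ ≤ j := sInf_le ⟨j, rfl, hfin⟩
        exact (hj.trans_le (h₁.trans h₂)).false
      · have := Module.notMem_support_iff.1 fun h => hpM (support_H_subset a j M h)
        infer_instance
    exact exists_pow_smul_eq_zero_of_finite_localizedModule a (powTorsion_H a j M) p

end main

end localCohomology

theorem fDimN_eq_hDim (R M : Type u) [CommRing R] [IsNoetherianRing R]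
    [IsLocalRing R] [IsAdicComplete (IsLocalRing.maximalIdeal R) R]
    [AddCommGroup M] [Module R M] [Module.Finite R M] (a : Ideal R) (n : ℕ) :
    fDimN R a M n = hDim R a M n := by
  refine le_antisymm (le_sInf ?_) (localCohomology.hDim_le_fDimN a n)
  rintro _ ⟨j, rfl, hj⟩
  by_contra! h
  exact hj ((localCohomology.inDimLT_iff _ n).2 (localCohomology.fgOn_H_of_lt_fDimN a n j h))
end
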